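/- arXiv:1510.00701 — 6 statements merged into one kernel-verified Lean document; each statement's English description precedes it below -/
import Mathlib

section
/- Let (Ω, ℱ) be a measurable space, let E be a set equipped with a semi-distance d : E × E → ℝ (d is nonnegative, symmetric, satisfies the triangle inequality, and d(x,x) = 0), let M ≥ 2 be an integer, let X_0, X_1, …, X_M ∈ E, let P_0, P_1, …, P_M be probability measures on Ω, and let s > 0. Suppose (i) d(X_j, X_k) ≥ 2s for all 0 ≤ j < k ≤ M, and (ii) (1/M)·∑_{j=1}^{M} K(P_j, P_0) ≤ α·log M for some 0 < α < 1/8. Then for every measurable map X̂ : Ω → E, max_{0 ≤ j ≤ M} P_j({ω : d(X̂(ω), X_j) ≥ s}) ≥ (√M/(1+√M))·(1 − 2α − √(2α/log M)) > 0. -/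
open MeasureTheory ProbabilityTheory
open scoped ENNReal NNReal

noncomputable section

instance {α : Type*} [MeasurableSpace α] : MeasurableSpace (Option α) :=
  MeasurableSpace.comap (fun o => (Option.elim o (Sum.inr ()) Sum.inl : α ⊕ Unit)) inferInstance

open Classical in
/-- The Kullback–Leibler divergence `K(P,Q) = ∫ log (dP/dQ) dP` when `P ≪ Q` (and the
log-likelihood ratio is integrable), and `+∞` otherwise. -/
def klDiv {α : Type*} [MeasurableSpace α] (P Q : Measure α) : ℝ≥0∞ :=
  if P ≪ Q ∧ Integrable (fun x => Real.log ((P.rnDeriv Q x).toReal)) P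
  then ENNReal.ofReal (∫ x, Real.log ((P.rnDeriv Q x).toReal) ∂P)
  else ⊤

/-- The Donsker–Varadhan lower bound for the Kullback–Leibler divergence. -/
lemma integral_sub_log_integral_exp_le_integral_llr {Ω : Type*} [MeasurableSpace Ω]
    {P Q : Measure Ω} [IsProbabilityMeasure P] [IsProbabilityMeasure Q] (hPQ : P ≪ Q)
    (hint : Integrable (llr P Q) P) {f : Ω → ℝ} (hfP : Integrable f P)
    (hfQ : Integrable (fun x => Real.exp (f x)) Q) :
    ∫ x, f x ∂P - Real.log (∫ x, Real.exp (f x) ∂Q) ≤ ∫ x, llr P Q x ∂P := by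
  have := isProbabilityMeasure_tilted hfQ
  have h := InformationTheory.integral_llr_add_sub_measure_univ_nonneg
    (hPQ.trans (absolutelyContinuous_tilted hfQ)) (integrable_llr_tilted_right hPQ hfP hint hfQ)
  rw [integral_llr_tilted_right hPQ hfP hfQ hint] at h
  simp only [probReal_univ] at h
  linarith

/-- Pinsker's inequality, for a single event. -/
lemma two_mul_sq_measureReal_sub_le_integral_llr {Ω : Type*} [MeasurableSpace Ω]
    {P Q : Measure Ω} [IsProbabilityMeasure P] [IsProbabilityMeasure Q] (hPQ : P ≪ Q)
    (hint : Integrable (llr P Q) P) {D : Set Ω} (hD : MeasurableSet D) :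
    2 * (P.real D - Q.real D) ^ 2 ≤ ∫ x, llr P Q x ∂P := by
  have hsub := hasSubgaussianMGF_of_mem_Icc (μ := Q) (X := D.indicator 1) (a := 0) (b := 1)
    (measurable_one.indicator hD).aemeasurable
    (ae_of_all _ fun x => by by_cases hx : x ∈ D <;> simp [hx])
  rw [integral_indicator_one hD] at hsub
  set t := 4 * (P.real D - Q.real D) with ht
  have hP : Integrable (D.indicator (1 : Ω → ℝ)) P := (integrable_const 1).indicator hD
  have hdv := integral_sub_log_integral_exp_le_integral_llr hPQ hint
    ((hP.sub (integrable_const (Q.real D))).const_mul t) (hsub.integrable_exp_mul t)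
  have hmgf := hsub.mgf_le t
  have hpos := integral_exp_pos (hsub.integrable_exp_mul t)
  rw [mgf] at hmgf
  have hlog := (Real.log_le_iff_le_exp hpos).2 hmgf
  simp only [Pi.sub_apply] at hdv
  rw [integral_const_mul, integral_sub hP (integrable_const _), integral_indicator_one hD] at hdv
  simp only [integral_const, probReal_univ, smul_eq_mul, one_mul] at hdv
  norm_num at hlog
  rw [ht] at hdv hlog
  nlinarith

/-- The Donsker–Varadhan bound for a multiple of an indicator, with the logarithm linearized. -/
lemma mul_measureReal_le_integral_llr_add {Ω : Type*} [MeasurableSpace Ω]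
    {P Q : Measure Ω} [IsProbabilityMeasure P] [IsProbabilityMeasure Q] (hPQ : P ≪ Q)
    (hint : Integrable (llr P Q) P) {D : Set Ω} (hD : MeasurableSet D) (L : ℝ) :
    L * P.real D ≤ ∫ x, llr P Q x ∂P + Q.real D * (Real.exp L - 1) := by
  have hexp : (fun x => Real.exp (D.indicator (fun _ => L) x)) =
      fun x => 1 + D.indicator (fun _ => Real.exp L - 1) x := by
    ext x
    by_cases hx : x ∈ D <;> simp [hx]
  have hQ : Integrable (D.indicator fun _ => Real.exp L - 1) Q :=
    (integrable_const _).indicator hD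
  have hexpQ : Integrable (fun x => Real.exp (D.indicator (fun _ => L) x)) Q := by
    rw [hexp]
    exact (integrable_const 1).add hQ
  have hdv := integral_sub_log_integral_exp_le_integral_llr hPQ hint
    ((integrable_const L).indicator hD) hexpQ
  have hlog := Real.log_le_sub_one_of_pos (integral_exp_pos hexpQ)
  have heq : ∫ x, Real.exp (D.indicator (fun _ => L) x) ∂Q =
      1 + Q.real D * (Real.exp L - 1) := by
    rw [hexp, integral_add (integrable_const 1) hQ, integral_indicator_const _ hD]
    simp
  rw [heq] at hdv hlog
  rw [integral_indicator_const _ hD, smul_eq_mul] at hdv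
  linarith

/-- A change-of-measure bound: `P C` exceeds `exp L * Q C` by at most `(K + √(K / 2)) / L`, where
`K` is the Kullback–Leibler divergence; the square root is linearized at `c`. -/
lemma mul_measureReal_sub_exp_mul_le {Ω : Type*} [MeasurableSpace Ω]
    {P Q : Measure Ω} [IsProbabilityMeasure P] [IsProbabilityMeasure Q] (hPQ : P ≪ Q)
    (hint : Integrable (llr P Q) P) (C : Set Ω) {L c : ℝ} (hL : 0 ≤ L)
    (hc : 0 < c) :
    L * (P.real C - Real.exp L * Q.real C) ≤
      ∫ x, llr P Q x ∂P + ((∫ x, llr P Q x ∂P) / 2 + c ^ 2) / (2 * c) := by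
  set K := ∫ x, llr P Q x ∂P
  set D : Set Ω := {x | ENNReal.ofReal (Real.exp L) ≤ P.rnDeriv Q x} with hDdef
  have hD : MeasurableSet D := measurableSet_le measurable_const (Measure.measurable_rnDeriv P Q)
  have hlow : Real.exp L * Q.real D ≤ P.real D := by
    have h : ENNReal.ofReal (Real.exp L) * Q D ≤ P D := by
      rw [← Measure.setLIntegral_rnDeriv hPQ D, ← setLIntegral_const]
      exact setLIntegral_mono (Measure.measurable_rnDeriv P Q) fun x hx => hx
    have h' := ENNReal.toReal_mono (measure_ne_top P D) h
    rwa [ENNReal.toReal_mul, ENNReal.toReal_ofReal (Real.exp_pos L).le] at h'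
  have hup : P.real (C \ D) ≤ Real.exp L * Q.real C := by
    have h : P (C \ D) ≤ ENNReal.ofReal (Real.exp L) * Q C := by
      rw [← Measure.setLIntegral_rnDeriv hPQ (C \ D)]
      calc ∫⁻ x in C \ D, P.rnDeriv Q x ∂Q
          ≤ ∫⁻ _ in C \ D, ENNReal.ofReal (Real.exp L) ∂Q :=
            setLIntegral_mono measurable_const fun x hx => (not_le.1 hx.2).le
        _ ≤ ENNReal.ofReal (Real.exp L) * Q C := by
            rw [setLIntegral_const]
            gcongr
            exact Set.sdiff_subset
    have h' := ENNReal.toReal_mono (by finiteness) h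
    rwa [ENNReal.toReal_mul, ENNReal.toReal_ofReal (Real.exp_pos L).le] at h'
  have hsplit : P.real C ≤ P.real (C \ D) + P.real D :=
    (measureReal_mono (by simp)).trans (measureReal_union_le (C \ D) D)
  have hpin := two_mul_sq_measureReal_sub_le_integral_llr hPQ hint hD
  have hmain := mul_measureReal_le_integral_llr_add hPQ hint hD L
  have hdiff : P.real D - Q.real D ≤ (K / 2 + c ^ 2) / (2 * c) := by
    rw [le_div_iff₀ (by positivity)]
    nlinarith [sq_nonneg (P.real D - Q.real D - c)]
  calc L * (P.real C - Real.exp L * Q.real C) ≤ L * P.real D := by gcongr; linarith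
    _ ≤ K + (K / 2 + c ^ 2) / (2 * c) := by linarith

lemma klDiv_ne_top_iff {Ω : Type*} [MeasurableSpace Ω] {P Q : Measure Ω} :
    klDiv P Q ≠ ⊤ ↔ P ≪ Q ∧ Integrable (llr P Q) P := by
  rw [klDiv, llr_def]
  split_ifs with h <;> simp [h]

lemma klDiv_eq_ofReal_integral_llr {Ω : Type*} [MeasurableSpace Ω] {P Q : Measure Ω}
    (h : klDiv P Q ≠ ⊤) : klDiv P Q = ENNReal.ofReal (∫ x, llr P Q x ∂P) :=
  if_pos (klDiv_ne_top_iff.1 h)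

lemma one_sub_two_mul_sub_sqrt_pos {M : ℕ} (hM : 2 ≤ M) {α : ℝ} (hα : α < 1 / 8) :
    0 < 1 - 2 * α - Real.sqrt (2 * α / Real.log M) := by
  have hlog : 0.69 < Real.log M :=
    (by linarith [Real.log_two_gt_d9] : (0.69 : ℝ) < Real.log 2).trans_le
      (Real.log_le_log (by norm_num) (by exact_mod_cast hM))
  have hsqrt : Real.sqrt (2 * α / Real.log M) ≤ 0.7 := by
    rw [Real.sqrt_le_left (by norm_num), div_le_iff₀ (by linarith)]
    linarith
  linarith

/-- The lower bound on the maximal error of a test between `M + 1` hypotheses. -/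
lemma le_of_forall_one_sub_le_measureReal {Ω : Type*} [MeasurableSpace Ω] {M : ℕ} (hM : 2 ≤ M)
    (P : Fin (M + 1) → Measure Ω) [∀ j, IsProbabilityMeasure (P j)] {α : ℝ} (hα : 0 < α)
    (hKL : (∑ j : Fin M, klDiv (P j.succ) (P 0)) / (M : ℝ≥0∞) ≤
      ENNReal.ofReal (α * Real.log M))
    {C : Fin (M + 1) → Set Ω} (hC : ∀ j, MeasurableSet (C j))
    (hdisj : Pairwise (Function.onFun Disjoint C)) {p : ℝ}
    (hp : ∀ j, 1 - p ≤ (P j).real (C j)) :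
    Real.sqrt M / (1 + Real.sqrt M) * (1 - 2 * α - Real.sqrt (2 * α / Real.log M)) ≤ p := by
  have hM1 : (1 : ℝ) < M := by exact_mod_cast hM
  have hM0 : (M : ℝ≥0∞) ≠ 0 := by simp; omega
  have hl : 0 < Real.log M := Real.log_pos hM1
  set l := Real.log M with hldef
  have hsum : ∑ j : Fin M, klDiv (P j.succ) (P 0) ≤ ENNReal.ofReal (α * l) * M := by
    rwa [ENNReal.div_le_iff hM0 (by simp)] at hKL
  have hfin (j : Fin M) : klDiv (P j.succ) (P 0) ≠ ⊤ :=
    ne_top_of_le_ne_top (by finiteness)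
      ((Finset.single_le_sum (fun _ _ => zero_le) (Finset.mem_univ j)).trans hsum)
  have hK0 (j : Fin M) : 0 ≤ ∫ x, llr (P j.succ) (P 0) x ∂(P j.succ) := by
    obtain ⟨h1, h2⟩ := klDiv_ne_top_iff.1 (hfin j)
    simpa using InformationTheory.integral_llr_add_sub_measure_univ_nonneg h1 h2
  set K : Fin M → ℝ := fun j => ∫ x, llr (P j.succ) (P 0) x ∂(P j.succ) with hK
  have hKsum : ∑ j, K j ≤ α * l * M := by
    rw [Finset.sum_congr rfl fun j _ => klDiv_eq_ofReal_integral_llr (hfin j),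
      ← ENNReal.ofReal_sum_of_nonneg fun j _ => hK0 j, ← ENNReal.ofReal_natCast M,
      ← ENNReal.ofReal_mul (by positivity), ENNReal.ofReal_le_ofReal_iff (by positivity)] at hsum
    exact hsum
  set r := Real.sqrt (2 * α / l) with hr
  have hr0 : 0 < r := Real.sqrt_pos.2 (by positivity)
  have hr2 : r ^ 2 * l = 2 * α := by
    rw [hr, Real.sq_sqrt (by positivity)]
    field_simp
  set q := Real.sqrt M with hq
  have hq0 : 0 < q := Real.sqrt_pos.2 (by linarith)
  have hq2 : q ^ 2 = M := Real.sq_sqrt (by linarith)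
  have hexp : Real.exp (l / 2) = q := by
    rw [hldef, ← Real.log_sqrt (by linarith), Real.exp_log hq0]
  have hstep (j : Fin M) : l / 2 * ((1 - p) - q * (P 0).real (C j.succ)) ≤
      K j + (K j / 2 + (r * l / 2) ^ 2) / (2 * (r * l / 2)) := by
    obtain ⟨h1, h2⟩ := klDiv_ne_top_iff.1 (hfin j)
    refine le_trans ?_ (mul_measureReal_sub_exp_mul_le h1 h2 (C j.succ) (L := l / 2)
      (by positivity) (by positivity))
    rw [hexp]
    gcongr
    exact hp j.succ
  have hnull : ∑ j : Fin M, (P 0).real (C j.succ) ≤ p := by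
    have h := measureReal_iUnion_fintype (μ := P 0) hdisj hC
    rw [Fin.sum_univ_succ] at h
    linarith [hp 0, measureReal_le_one (μ := P 0) (s := ⋃ j, C j)]
  have htotal := Finset.sum_le_sum fun j (_ : j ∈ Finset.univ) => hstep j
  rw [← Finset.mul_sum, Finset.sum_sub_distrib, ← Finset.mul_sum, Finset.sum_add_distrib,
    ← Finset.sum_div, Finset.sum_add_distrib, ← Finset.sum_div] at htotal
  simp only [Finset.sum_const, Finset.card_univ, Fintype.card_fin, nsmul_eq_mul] at htotal
  have hbound : l / 2 * (M * (1 - p) - q * p) ≤ l / 2 * (M * (2 * α + r)) := by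
    calc l / 2 * (M * (1 - p) - q * p)
        ≤ l / 2 * (M * (1 - p) - q * ∑ j : Fin M, (P 0).real (C j.succ)) := by gcongr
      _ ≤ α * l * M + (α * l * M / 2 + M * (r * l / 2) ^ 2) / (2 * (r * l / 2)) :=
          htotal.trans (by gcongr)
      _ = l / 2 * (M * (2 * α + r)) := by
          rw [show α = r ^ 2 * l / 2 by linarith]
          field_simp
          ring
  have hfinal := le_of_mul_le_mul_left hbound (by positivity)
  rw [div_mul_eq_mul_div, div_le_iff₀ (by positivity)]
  refine le_of_mul_le_mul_left ?_ hq0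
  rw [← hq2] at hfinal
  linarith

/-- Tsybakov's method, Theorem 2.5 of Tsybakov: lower bound on the maximal
error probability over a finite family of hypotheses separated in a semi-distance, whose
distributions are close in Kullback–Leibler divergence. -/
theorem tsybakov_lower_bound {Ω : Type*} [MeasurableSpace Ω] {E : Type*} [MeasurableSpace E]
    (d : E → E → ℝ)
    (hd_nonneg : ∀ x y, 0 ≤ d x y) (hd_symm : ∀ x y, d x y = d y x)
    (hd_tri : ∀ x y z, d x z ≤ d x y + d y z) (hd_refl : ∀ x, d x x = 0)
    (M : ℕ) (hM : 2 ≤ M) (X : Fin (M + 1) → E) (P : Fin (M + 1) → Measure Ω)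
    (hP : ∀ j, IsProbabilityMeasure (P j)) (s : ℝ) (hs : 0 < s)
    (hsep : ∀ j k : Fin (M + 1), j < k → 2 * s ≤ d (X j) (X k))
    (α : ℝ) (hα0 : 0 < α) (hα1 : α < 1 / 8)
    (hKL : (∑ j : Fin M, klDiv (P j.succ) (P 0)) / (M : ℝ≥0∞) ≤
      ENNReal.ofReal (α * Real.log M)) :
    (0 : ℝ) <
      Real.sqrt M / (1 + Real.sqrt M) * (1 - 2 * α - Real.sqrt (2 * α / Real.log M)) ∧
    ∀ Xhat : Ω → E, Measurable Xhat →
      ENNReal.ofReal (Real.sqrt M / (1 + Real.sqrt M) *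
          (1 - 2 * α - Real.sqrt (2 * α / Real.log M))) ≤
        ⨆ j : Fin (M + 1), P j {ω | s ≤ d (Xhat ω) (X j)} := by
  have hpos := one_sub_two_mul_sub_sqrt_pos hM hα1
  have hM0 : (0 : ℝ) < M := by exact_mod_cast (by omega : 0 < M)
  refine ⟨mul_pos (by positivity) hpos, fun Xhat _ => ?_⟩
  set A : Fin (M + 1) → Set Ω := fun j => {ω | s ≤ d (Xhat ω) (X j)}
  have hcover {j k : Fin (M + 1)} (hjk : j < k) (ω : Ω) : ω ∈ A j ∨ ω ∈ A k := by
    by_contra! h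
    simp only [A, Set.mem_ofPred_eq, not_le] at h
    linarith [hsep j k hjk, hd_tri (X j) (Xhat ω) (X k), hd_symm (X j) (Xhat ω)]
  -- The sets `A j` need not be measurable, so they are replaced by measurable hulls.
  have hdisj : Pairwise (Function.onFun Disjoint fun j => (toMeasurable (P j) (A j))ᶜ) := by
    intro j k hjk
    refine Set.disjoint_left.2 fun ω hj hk => ?_
    have hj' : ω ∉ A j := fun h => hj (subset_toMeasurable _ _ h)
    have hk' : ω ∉ A k := fun h => hk (subset_toMeasurable _ _ h)
    rcases hjk.lt_or_gt with h | h
    · exact (hcover h ω).elim hj' hk'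
    · exact (hcover h ω).elim hk' hj'
  have hsup : ⨆ j, P j (A j) ≠ ⊤ :=
    ne_top_of_le_ne_top ENNReal.one_ne_top (iSup_le fun j => prob_le_one)
  refine ENNReal.ofReal_le_of_le_toReal
    (le_of_forall_one_sub_le_measureReal hM P hα0 hKL
      (fun j => (measurableSet_toMeasurable _ _).compl) hdisj fun j => ?_)
  rw [probReal_compl_eq_one_sub (measurableSet_toMeasurable _ _), measureReal_def,
    measure_toMeasurable]
  gcongr
  exact le_iSup (fun j => P j (A j)) j

end
end

section
/- For every τ > 0 and all x, y ∈ ℝ, the Kullback–Leibler divergence between the Laplace measures Laplace(x,τ) and Laplace(y,τ) satisfies K(Laplace(x,τ), Laplace(y,τ)) = τ|x−y| − (1 − exp(−τ|x−y|)). -/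
open MeasureTheory ProbabilityTheory
open scoped ENNReal NNReal

noncomputable section

/-- The Laplace measure on `ℝ` centered at `x` with parameter `τ`, having density
`z ↦ (τ/2) exp (−τ|z−x|)` with respect to Lebesgue measure. -/
def laplaceMeasure (x τ : ℝ) : Measure ℝ :=
  volume.withDensity fun z => ENNReal.ofReal (τ / 2 * Real.exp (-(τ * |z - x|)))

open Set in
theorem integrable_exp_neg_mul_abs {τ : ℝ} (hτ : 0 < τ) :
    Integrable fun u : ℝ => Real.exp (-(τ * |u|)) := by
  rw [← integrableOn_univ, ← Iic_union_Ioi (a := (0 : ℝ))]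
  refine IntegrableOn.union ?_ ?_
  · refine (integrableOn_exp_mul_Iic hτ 0).congr_fun (fun u hu => ?_) measurableSet_Iic
    simp [abs_of_nonpos (mem_Iic.1 hu)]
  · refine (integrableOn_exp_mul_Ioi (neg_neg_of_pos hτ) 0).congr_fun (fun u hu => ?_)
      measurableSet_Ioi
    simp [abs_of_pos (mem_Ioi.1 hu)]

open Set in
theorem integral_exp_neg_mul_abs_mul_abs_sub_of_nonneg {τ a : ℝ} (hτ : 0 < τ) (ha : 0 ≤ a) :
    ∫ u : ℝ, τ / 2 * Real.exp (-(τ * |u|)) * (τ * (|u - a| - |u|)) =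
      τ * a - (1 - Real.exp (-(τ * a))) := by
  have hL : EqOn (fun u : ℝ => τ ^ 2 * a / 2 * Real.exp (τ * u))
      (fun u => τ / 2 * Real.exp (-(τ * |u|)) * (τ * (|u - a| - |u|))) (Iic 0) := fun u hu => by
    have hu' : u ≤ 0 := hu
    simp only [abs_of_nonpos hu', abs_of_nonpos (by linarith : u - a ≤ 0)]
    rw [show -(τ * -u) = τ * u by ring]
    ring
  have hR : EqOn (fun u : ℝ => -(τ ^ 2 * a / 2) * Real.exp (-τ * u))
      (fun u => τ / 2 * Real.exp (-(τ * |u|)) * (τ * (|u - a| - |u|))) (Ioi a) := fun u hu => by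
    have hu' : a < u := hu
    simp only [abs_of_nonneg (ha.trans hu'.le), abs_of_nonneg (by linarith : 0 ≤ u - a)]
    rw [neg_mul τ u]
    ring
  have hiL := IntegrableOn.congr_fun
    ((integrableOn_exp_mul_Iic hτ 0).const_mul (τ ^ 2 * a / 2)) hL measurableSet_Iic
  have hiR := IntegrableOn.congr_fun
    ((integrableOn_exp_mul_Ioi (neg_neg_of_pos hτ) a).const_mul (-(τ ^ 2 * a / 2))) hR
    measurableSet_Ioi
  have hcont : Continuous
      fun u : ℝ => τ / 2 * Real.exp (-(τ * |u|)) * (τ * (|u - a| - |u|)) := by fun_prop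
  have hint := hcont.intervalIntegrable (μ := volume) 0 a
  have hiM := (intervalIntegrable_iff_integrableOn_Ioc_of_le ha).1 hint
  have hiR0 : IntegrableOn
      (fun u : ℝ => τ / 2 * Real.exp (-(τ * |u|)) * (τ * (|u - a| - |u|))) (Ioi 0) := by
    rw [← Ioc_union_Ioi_eq_Ioi ha]
    exact hiM.union hiR
  have hM : ∫ u in (0 : ℝ)..a, τ / 2 * Real.exp (-(τ * |u|)) * (τ * (|u - a| - |u|)) =
      (τ * a / 2 + 1) * Real.exp (-(τ * a)) - (1 - τ * a / 2) := by
    have hd (u : ℝ) : HasDerivAt (fun u => (1 - τ / 2 * (a - 2 * u)) * Real.exp (-(τ * u)))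
        (τ ^ 2 / 2 * (a - 2 * u) * Real.exp (-(τ * u))) u := by
      have h1 : HasDerivAt (fun u => 1 - τ / 2 * (a - 2 * u)) τ u := by
        have := ((((hasDerivAt_id u).const_mul 2).const_sub a).const_mul (τ / 2)).const_sub 1
        convert! this using 1
        ring
      have h2 : HasDerivAt (fun u => Real.exp (-(τ * u))) (Real.exp (-(τ * u)) * -τ) u := by
        simpa using ((hasDerivAt_id u).const_mul τ).neg.exp
      convert! h1.mul h2 using 1
      ring
    rw [intervalIntegral.integral_congr (g := fun u =>
      τ ^ 2 / 2 * (a - 2 * u) * Real.exp (-(τ * u))), intervalIntegral.integral_eq_sub_of_hasDerivAt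
        (fun u _ => hd u) (Continuous.intervalIntegrable (by fun_prop) _ _)]
    · simp only [mul_zero, neg_zero, Real.exp_zero]
      ring
    · intro u hu
      rw [uIcc_of_le ha] at hu
      simp only [abs_of_nonneg hu.1, abs_of_nonpos (sub_nonpos.2 hu.2)]
      ring
  rw [← intervalIntegral.integral_Iic_add_Ioi hiL hiR0,
    ← intervalIntegral.integral_interval_add_Ioi hiR0 hiR, hM,
    ← setIntegral_congr_fun measurableSet_Iic hL, ← setIntegral_congr_fun measurableSet_Ioi hR,
    integral_const_mul, integral_const_mul, integral_exp_mul_Iic hτ,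
    integral_exp_mul_Ioi (neg_neg_of_pos hτ), neg_mul τ a]
  simp only [mul_zero, Real.exp_zero]
  field_simp
  ring

theorem integral_exp_neg_mul_abs_mul_abs_sub {τ : ℝ} (hτ : 0 < τ) (a : ℝ) :
    ∫ u : ℝ, τ / 2 * Real.exp (-(τ * |u|)) * (τ * (|u - a| - |u|)) =
      τ * |a| - (1 - Real.exp (-(τ * |a|))) := by
  rcases le_total 0 a with ha | ha
  · rw [abs_of_nonneg ha, integral_exp_neg_mul_abs_mul_abs_sub_of_nonneg hτ ha]
  · rw [abs_of_nonpos ha, ← integral_exp_neg_mul_abs_mul_abs_sub_of_nonneg hτ (neg_nonneg.2 ha),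
      ← integral_neg_eq_self]
    refine integral_congr_ae (.of_forall fun u => ?_)
    simp only [abs_neg]
    rw [← abs_neg (-u - a), show -(-u - a) = u - -a by ring]

theorem isFiniteMeasure_laplaceMeasure {τ : ℝ} (hτ : 0 < τ) (x : ℝ) :
    IsFiniteMeasure (laplaceMeasure x τ) :=
  isFiniteMeasure_withDensity_ofReal
    (((integrable_exp_neg_mul_abs hτ).comp_sub_right x).const_mul (τ / 2)).2

theorem laplaceMeasure_eq_withDensity {τ : ℝ} (hτ : 0 < τ) (x y : ℝ) :
    laplaceMeasure x τ = (laplaceMeasure y τ).withDensity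
      fun z => ENNReal.ofReal (Real.exp (τ * (|z - y| - |z - x|))) := by
  rw [laplaceMeasure, laplaceMeasure, ← withDensity_mul _ (by fun_prop) (by fun_prop)]
  congr 1
  ext z
  rw [Pi.mul_apply, ← ENNReal.ofReal_mul (by positivity), mul_assoc, ← Real.exp_add]
  ring_nf

theorem integral_laplaceMeasure {τ : ℝ} (hτ : 0 < τ) (x : ℝ) (f : ℝ → ℝ) :
    ∫ z, f z ∂laplaceMeasure x τ = ∫ z, τ / 2 * Real.exp (-(τ * |z - x|)) * f z := by
  rw [laplaceMeasure, integral_withDensity_eq_integral_toReal_smul (by fun_prop)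
    (.of_forall fun _ => ENNReal.ofReal_lt_top)]
  refine integral_congr_ae (.of_forall fun z => ?_)
  simp only [smul_eq_mul]
  rw [ENNReal.toReal_ofReal (by positivity)]

/-- the KL divergence between Laplace measures with common parameter `τ`
and centers `x`, `y` equals `τ|x−y| − (1 − exp(−τ|x−y|))`. -/
theorem klDiv_laplace (τ x y : ℝ) (hτ : 0 < τ) :
    klDiv (laplaceMeasure x τ) (laplaceMeasure y τ) =
      ENNReal.ofReal (τ * |x - y| - (1 - Real.exp (-(τ * |x - y|)))) := by
  have := isFiniteMeasure_laplaceMeasure hτ x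
  have := isFiniteMeasure_laplaceMeasure hτ y
  have hPQ := laplaceMeasure_eq_withDensity hτ x y
  have hac : laplaceMeasure x τ ≪ laplaceMeasure y τ :=
    hPQ ▸ withDensity_absolutelyContinuous _ _
  have hlog : (fun z => Real.log (((laplaceMeasure x τ).rnDeriv (laplaceMeasure y τ) z).toReal))
      =ᵐ[laplaceMeasure x τ] fun z => τ * (|z - y| - |z - x|) := by
    have h := Measure.rnDeriv_withDensity (laplaceMeasure y τ)
      (f := fun z => ENNReal.ofReal (Real.exp (τ * (|z - y| - |z - x|)))) (by fun_prop)
    rw [← hPQ] at h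
    filter_upwards [hac.ae_le h] with z hz
    rw [hz, ENNReal.toReal_ofReal (Real.exp_nonneg _), Real.log_exp]
  have hint : Integrable (fun z => τ * (|z - y| - |z - x|)) (laplaceMeasure x τ) := by
    refine .of_bound (by fun_prop) (τ * |x - y|) (.of_forall fun z => ?_)
    rw [norm_mul, Real.norm_of_nonneg hτ.le, Real.norm_eq_abs]
    refine mul_le_mul_of_nonneg_left ?_ hτ.le
    simpa using abs_abs_sub_abs_le_abs_sub (z - y) (z - x)
  rw [klDiv, if_pos ⟨hac, (integrable_congr hlog).2 hint⟩, integral_congr_ae hlog,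
    integral_laplaceMeasure hτ, ← integral_add_right_eq_self _ x, abs_sub_comm x y,
    ← integral_exp_neg_mul_abs_mul_abs_sub hτ]
  congr 2
  ext u
  rw [add_sub_cancel_right, show u + x - y = u - (y - x) by ring]

end
end

section
/- Let B > 0 and let F : ℝ → ℝ be differentiable with derivative f and satisfy 0 < F(t) < 1 for all t with |t| ≤ B. Define c_{F,B} := (sup_{|t| ≤ B} 1/(F(t)(1−F(t))))^{1/2} · (sup_{|t| ≤ B} f(t)²)^{1/2}, and assume c_{F,B} is finite. Then for all x, y ∈ ℝ with |x| ≤ B and |y| ≤ B, the Kullback–Leibler divergence between the Bernoulli distributions with parameters F(x) and F(y) satisfies K(Bernoulli(F(x)), Bernoulli(F(y))) = F(x)·log(F(x)/F(y)) + (1−F(x))·log((1−F(x))/(1−F(y))) ≤ (1/2)·c_{F,B}²·(x−y)². -/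
open MeasureTheory ProbabilityTheory
open scoped ENNReal NNReal

noncomputable section

/-- The Bernoulli measure on `Bool`, assigning mass `p` to `true` (i.e. to `1`)
and mass `1 - p` to `false` (i.e. to `0`). -/
def bernoulliMeasure (p : ℝ) : Measure Bool :=
  ENNReal.ofReal p • Measure.dirac true + ENNReal.ofReal (1 - p) • Measure.dirac false

theorem bernoulliMeasure_eq_withDensity {p q : ℝ} (hq0 : 0 < q) (hq1 : q < 1) :
    _root_.bernoulliMeasure p = (_root_.bernoulliMeasure q).withDensity
      (fun b => ENNReal.ofReal (if b then p / q else (1 - p) / (1 - q))) := by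
  have hq : 0 < 1 - q := sub_pos.2 hq1
  ext s hs
  rw [withDensity_apply _ hs, ← lintegral_indicator hs]
  simp only [_root_.bernoulliMeasure, lintegral_add_measure, lintegral_smul_measure,
    lintegral_dirac, Measure.add_apply, Measure.smul_apply, Measure.dirac_apply, smul_eq_mul]
  congr 1
  · by_cases h : true ∈ s
    · simp [h, ← ENNReal.ofReal_mul hq0.le, mul_div_cancel₀ _ hq0.ne']
    · simp [h]
  · by_cases h : false ∈ s
    · simp [h, ← ENNReal.ofReal_mul hq.le, mul_div_cancel₀ _ hq.ne']
    · simp [h]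

instance (p : ℝ) : IsFiniteMeasure (_root_.bernoulliMeasure p) :=
  ⟨by simp [_root_.bernoulliMeasure]⟩

theorem integral_bernoulliMeasure {p : ℝ} (hp0 : 0 ≤ p) (hp1 : p ≤ 1) (g : Bool → ℝ) :
    ∫ b, g b ∂(_root_.bernoulliMeasure p) = p * g true + (1 - p) * g false := by
  have h (r : ℝ) (b : Bool) : Integrable g (ENNReal.ofReal r • Measure.dirac b) :=
    Integrable.of_finite.smul_measure ENNReal.ofReal_ne_top
  rw [_root_.bernoulliMeasure, integral_add_measure (h _ _) (h _ _), integral_smul_measure,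
    integral_smul_measure, integral_dirac, integral_dirac, ENNReal.toReal_ofReal hp0,
    ENNReal.toReal_ofReal (sub_nonneg.2 hp1), smul_eq_mul, smul_eq_mul]

theorem klDiv_bernoulliMeasure {p q : ℝ} (hp0 : 0 ≤ p) (hp1 : p ≤ 1) (hq0 : 0 < q)
    (hq1 : q < 1) :
    klDiv (_root_.bernoulliMeasure p) (_root_.bernoulliMeasure q) =
      ENNReal.ofReal (p * Real.log (p / q) + (1 - p) * Real.log ((1 - p) / (1 - q))) := by
  have hd := bernoulliMeasure_eq_withDensity (p := p) hq0 hq1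
  have hac : _root_.bernoulliMeasure p ≪ _root_.bernoulliMeasure q := by
    rw [hd]
    exact withDensity_absolutelyContinuous _ _
  have hrn : (_root_.bernoulliMeasure p).rnDeriv (_root_.bernoulliMeasure q) =ᵐ[_root_.bernoulliMeasure p]
      fun b => ENNReal.ofReal (if b then p / q else (1 - p) / (1 - q)) := by
    refine hac.ae_le ?_
    rw [hd]
    exact Measure.rnDeriv_withDensity _ (measurable_of_finite _)
  rw [klDiv, if_pos ⟨hac, Integrable.of_finite⟩]
  congr 1
  have hlog : (fun b => Real.log
      (((_root_.bernoulliMeasure p).rnDeriv (_root_.bernoulliMeasure q) b).toReal)) =ᵐ[_root_.bernoulliMeasure p]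
      fun b => Real.log (if b then p / q else (1 - p) / (1 - q)) := by
    filter_upwards [hrn] with b hb
    rw [hb, ENNReal.toReal_ofReal]
    have h1 := div_nonneg hp0 hq0.le
    have h2 := div_nonneg (sub_nonneg.2 hp1) (sub_nonneg.2 hq1.le)
    split_ifs <;> assumption
  rw [integral_congr_ae hlog, integral_bernoulliMeasure hp0 hp1]
  simp

/-- The derivative of the binary relative entropy in its second argument. -/
theorem hasDerivAt_binary_relative_entropy {p : ℝ} (hp0 : 0 < p) (hp1 : p < 1) {G : ℝ → ℝ}
    {g s : ℝ} (hG : HasDerivAt G g s) (h0 : 0 < G s) (h1 : G s < 1) :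
    HasDerivAt (fun s => p * Real.log (p / G s) + (1 - p) * Real.log ((1 - p) / (1 - G s)))
      (g * (G s - p) * (1 / (G s * (1 - G s)))) s := by
  have h1' : 0 < 1 - G s := sub_pos.2 h1
  have hp1' : 0 < 1 - p := sub_pos.2 hp1
  have d1 := (((hasDerivAt_const s p).fun_div hG h0.ne').log (div_pos hp0 h0).ne').const_mul p
  have d2 := (((hasDerivAt_const s (1 - p)).fun_div (hG.const_sub 1) h1'.ne').log
    (div_pos hp1' h1').ne').const_mul (1 - p)
  refine (d1.fun_add d2).congr_deriv ?_
  have := h0.ne'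
  have := h1'.ne'
  have := hp0.ne'
  have := hp1'.ne'
  field_simp
  ring

theorem binary_relative_entropy_le {B M l : ℝ} {F f : ℝ → ℝ}
    (hF : ∀ t, HasDerivAt F (f t) t) (hF01 : ∀ t : ℝ, |t| ≤ B → 0 < F t ∧ F t < 1)
    (hM : ∀ t, |t| ≤ B → 1 / (F t * (1 - F t)) ≤ M) (hl : ∀ t, |t| ≤ B → |f t| ≤ l)
    {x y : ℝ} (hx : |x| ≤ B) (hy : |y| ≤ B) :
    F x * Real.log (F x / F y) + (1 - F x) * Real.log ((1 - F x) / (1 - F y)) ≤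
      1 / 2 * (M * l ^ 2) * (x - y) ^ 2 := by
  have hconv : Convex ℝ {t : ℝ | |t| ≤ B} := by
    simpa only [Set.Icc, abs_le] using convex_Icc (-B) B
  have hl0 : 0 ≤ l := (abs_nonneg _).trans (hl x hx)
  have hseg : ∀ s ∈ Set.Icc (0 : ℝ) 1, |x + s * (y - x)| ≤ B := fun s hs => by
    simpa using hconv.add_smul_sub_mem hx hy hs
  have hlip : ∀ t, |t| ≤ B → |F t - F x| ≤ l * |t - x| := fun t ht =>
    hconv.norm_image_sub_le_of_norm_hasDerivWithin_le
      (fun u _ => (hF u).hasDerivWithinAt) hl hx ht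
  obtain ⟨hx0, hx1⟩ := hF01 x hx
  let h : ℝ → ℝ := fun s =>
    (F x * Real.log (F x / F (x + s * (y - x))) +
      (1 - F x) * Real.log ((1 - F x) / (1 - F (x + s * (y - x))))) -
    1 / 2 * (M * l ^ 2) * (y - x) ^ 2 * s ^ 2
  have hderiv : ∀ s ∈ Set.Icc (0 : ℝ) 1, HasDerivAt h
      (f (x + s * (y - x)) * (y - x) * (F (x + s * (y - x)) - F x) *
        (1 / (F (x + s * (y - x)) * (1 - F (x + s * (y - x))))) -
        M * l ^ 2 * (y - x) ^ 2 * s) s := fun s hs => by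
    obtain ⟨h0, h1⟩ := hF01 _ (hseg s hs)
    have hlin : HasDerivAt (fun s : ℝ => x + s * (y - x)) (y - x) s := by
      simpa using ((hasDerivAt_id s).mul_const (y - x)).const_add x
    have hG := (hF (x + s * (y - x))).comp s hlin
    have hsq := (hasDerivAt_pow 2 s).const_mul (1 / 2 * (M * l ^ 2) * (y - x) ^ 2)
    refine ((hasDerivAt_binary_relative_entropy hx0 hx1 hG h0 h1).fun_sub hsq).congr_deriv ?_
    simp only [Function.comp_apply, Nat.cast_ofNat]
    ring
  have hanti : AntitoneOn h (Set.Icc 0 1) := by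
    refine antitoneOn_of_hasDerivWithinAt_nonpos (convex_Icc 0 1)
      (fun s hs => (hderiv s hs).continuousAt.continuousWithinAt)
      (fun s hs => (hderiv s (interior_subset hs)).hasDerivWithinAt) fun s hs => ?_
    have hs := interior_subset hs
    obtain ⟨h0, h1⟩ := hF01 _ (hseg s hs)
    have hm := hM _ (hseg s hs)
    have hf := hl _ (hseg s hs)
    have hd := hlip _ (hseg s hs)
    have hpos : 0 < 1 / (F (x + s * (y - x)) * (1 - F (x + s * (y - x)))) :=
      one_div_pos.2 (mul_pos h0 (sub_pos.2 h1))
    rw [add_sub_cancel_left, abs_mul, abs_of_nonneg hs.1] at hd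
    have hprod : f (x + s * (y - x)) * (y - x) * (F (x + s * (y - x)) - F x) ≤
        l * |y - x| * (l * (s * |y - x|)) := by
      refine (le_abs_self _).trans ?_
      rw [abs_mul, abs_mul]
      gcongr
    have hs0 := hs.1
    have hfin := mul_le_mul hprod hm hpos.le (by positivity)
    have hsq := sq_abs (y - x)
    rw [sub_nonpos]
    refine hfin.trans_eq ?_
    rw [← hsq]
    ring
  have key := hanti (Set.left_mem_Icc.2 zero_le_one) (Set.right_mem_Icc.2 zero_le_one) zero_le_one
  simp only [h, zero_mul, add_zero, one_mul, add_sub_cancel, div_self hx0.ne',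
    div_self (sub_pos.2 hx1).ne', Real.log_one, mul_zero, one_pow, mul_one, ne_eq,
    OfNat.ofNat_ne_zero, not_false_eq_true, zero_pow, sub_zero] at key
  linarith [sub_sq_comm x y ▸ sub_nonpos.1 key]

/-- the KL divergence between Bernoulli distributions with parameters
`F x`, `F y` and the quadratic upper bound `½ c_{F,B}² (x−y)²`. -/
theorem klDiv_bernoulli_one_bit (B : ℝ) (hB : 0 < B) (F f : ℝ → ℝ)
    (hF : ∀ t, HasDerivAt F (f t) t)
    (hF01 : ∀ t : ℝ, |t| ≤ B → 0 < F t ∧ F t < 1)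
    (hbdd1 : BddAbove {v : ℝ | ∃ t, |t| ≤ B ∧ v = 1 / (F t * (1 - F t))})
    (hbdd2 : BddAbove {v : ℝ | ∃ t, |t| ≤ B ∧ v = f t ^ 2})
    (c : ℝ)
    (hc : c = Real.sqrt (sSup {v : ℝ | ∃ t, |t| ≤ B ∧ v = 1 / (F t * (1 - F t))}) *
      Real.sqrt (sSup {v : ℝ | ∃ t, |t| ≤ B ∧ v = f t ^ 2}))
    (x y : ℝ) (hx : |x| ≤ B) (hy : |y| ≤ B) :
    klDiv (bernoulliMeasure (F x)) (bernoulliMeasure (F y)) =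
      ENNReal.ofReal (F x * Real.log (F x / F y) +
        (1 - F x) * Real.log ((1 - F x) / (1 - F y))) ∧
    F x * Real.log (F x / F y) + (1 - F x) * Real.log ((1 - F x) / (1 - F y)) ≤
      1 / 2 * c ^ 2 * (x - y) ^ 2 := by
  obtain ⟨hx0, hx1⟩ := hF01 x hx
  obtain ⟨hy0, hy1⟩ := hF01 y hy
  refine ⟨klDiv_bernoulliMeasure hx0.le hx1.le hy0 hy1, ?_⟩
  have hM : ∀ t, |t| ≤ B → 1 / (F t * (1 - F t)) ≤
      sSup {v : ℝ | ∃ t, |t| ≤ B ∧ v = 1 / (F t * (1 - F t))} :=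
    fun t ht => le_csSup hbdd1 ⟨t, ht, rfl⟩
  have hl : ∀ t, |t| ≤ B → |f t| ≤ Real.sqrt (sSup {v : ℝ | ∃ t, |t| ≤ B ∧ v = f t ^ 2}) :=
    fun t ht => Real.abs_le_sqrt (le_csSup hbdd2 ⟨t, ht, rfl⟩)
  have hM0 : 0 ≤ sSup {v : ℝ | ∃ t, |t| ≤ B ∧ v = 1 / (F t * (1 - F t))} :=
    (one_div_pos.2 (mul_pos hx0 (sub_pos.2 hx1))).le.trans (hM x hx)
  rw [hc, mul_pow, Real.sq_sqrt hM0]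
  exact binary_relative_entropy_le hF hF01 hM hl hx hy

end
end

section
/- Let (P_x)_{x∈ℝ} be a measurable family of probability measures on a measurable space E, let n₁, n₂ be positive integers, and let γ ∈ [0,1]. For a matrix X ∈ ℝ^{n₁×n₂} let Q_X denote the product measure over (i,j) ∈ [n₁]×[n₂] of the measures γ·(Option.some)_*P_{X_{i,j}} + (1−γ)·δ_{Option.none} on Option E. Then for all matrices X, X′ ∈ ℝ^{n₁×n₂}, the Kullback–Leibler divergence satisfies K(Q_X, Q_{X′}) = γ·∑_{(i,j)∈[n₁]×[n₂]} K(P_{X_{i,j}}, P_{X′_{i,j}}). -/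
open MeasureTheory ProbabilityTheory
open scoped ENNReal NNReal

noncomputable section

/-- Squared Frobenius norm of a real matrix. -/
def frobSq {n₁ n₂ : ℕ} (X : Matrix (Fin n₁) (Fin n₂) ℝ) : ℝ :=
  ∑ i, ∑ j, (X i j) ^ 2

/-- The sparse-factor model class `𝒳(r,k,A_max)`. -/
def sparseClass (n₁ n₂ r k : ℕ) (Amax : ℝ) : Set (Matrix (Fin n₁) (Fin n₂) ℝ) :=
  {X | ∃ (D : Matrix (Fin n₁) (Fin r) ℝ) (A : Matrix (Fin r) (Fin n₂) ℝ),
    X = D * A ∧ (∀ i j, |D i j| ≤ 1) ∧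
    (Finset.univ.filter fun p : Fin r × Fin n₂ => A p.1 p.2 ≠ 0).card ≤ k ∧
    ∀ i j, |A i j| ≤ Amax}

/-- `Δ(k,n₂) = min{1, k/n₂}`. -/
def Delta (k n₂ : ℕ) : ℝ := min 1 ((k : ℝ) / (n₂ : ℝ))

instance {n₁ n₂ : ℕ} : MeasurableSpace (Matrix (Fin n₁) (Fin n₂) ℝ) :=
  inferInstanceAs (MeasurableSpace (Fin n₁ → Fin n₂ → ℝ))

/-- The distribution of the observations generated by the matrix `X`: each entry is observed
independently with probability `γ`, an observed entry being drawn from `P (X i j)`. -/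
def obsMeasure {E : Type*} [MeasurableSpace E] {n₁ n₂ : ℕ} (P : ℝ → Measure E) (γ : ℝ≥0∞)
    (X : Matrix (Fin n₁) (Fin n₂) ℝ) : Measure (Fin n₁ × Fin n₂ → Option E) :=
  Measure.pi fun p =>
    γ • (P (X p.1 p.2)).map Option.some + (1 - γ) • Measure.dirac (none : Option E)

/-- The minimax risk (normalized expected squared Frobenius error) over a class `𝒞`
of `n₁ × n₂` matrices, for the observation model `obsMeasure P γ`. -/
def minimaxRisk {E : Type*} [MeasurableSpace E] {n₁ n₂ : ℕ} (P : ℝ → Measure E) (γ : ℝ≥0∞)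
    (𝒞 : Set (Matrix (Fin n₁) (Fin n₂) ℝ)) : ℝ≥0∞ :=
  ⨅ (Xhat : (Fin n₁ × Fin n₂ → Option E) → Matrix (Fin n₁) (Fin n₂) ℝ)
    (_ : Measurable Xhat),
    ⨆ X ∈ 𝒞,
      (∫⁻ ω, ENNReal.ofReal (frobSq (Xhat ω - X)) ∂obsMeasure P γ X) / ((n₁ : ℝ≥0∞) * n₂)

section Option

variable {E β : Type*} [MeasurableSpace E] [MeasurableSpace β]

theorem measurableSet_option_iff {s : Set (Option E)} :
    MeasurableSet s ↔ MeasurableSet (some ⁻¹' s) := by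
  constructor
  · rintro ⟨t, ht, rfl⟩
    exact measurable_inl ht
  · intro h
    classical
    refine ⟨Sum.inl '' (some ⁻¹' s) ∪ Sum.inr '' {_u | none ∈ s},
      h.inl_image.union (MeasurableSet.inr_image .of_discrete), ?_⟩
    ext (_ | x) <;> simp

theorem measurable_option_some : Measurable (some : E → Option E) :=
  fun _ hs => measurableSet_option_iff.1 hs

theorem measurable_option_iff {f : Option E → β} :
    Measurable f ↔ Measurable fun x => f (some x) :=
  ⟨fun h => h.comp measurable_option_some,
    fun h _ ht => measurableSet_option_iff.2 (h ht)⟩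

theorem lintegral_option_mixture (a b : ℝ≥0∞) (P : Measure E) {g : Option E → ℝ≥0∞}
    (hg : Measurable g) :
    ∫⁻ o, g o ∂(a • P.map some + b • Measure.dirac (none : Option E)) =
      a * ∫⁻ x, g (some x) ∂P + b * g none := by
  rw [lintegral_add_measure, lintegral_smul_measure, lintegral_smul_measure,
    lintegral_map hg measurable_option_some, lintegral_dirac' _ hg, smul_eq_mul, smul_eq_mul]

theorem option_mixture_withDensity (a b : ℝ≥0∞) (P : Measure E) {f : E → ℝ≥0∞}
    (hf : Measurable f) :
    (a • P.map some + b • Measure.dirac (none : Option E)).withDensity (fun o => o.elim 1 f) =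
      a • (P.withDensity f).map some + b • Measure.dirac (none : Option E) := by
  have hf' : Measurable fun o : Option E => o.elim 1 f := measurable_option_iff.2 hf
  ext s hs
  have hs' := measurableSet_option_iff.1 hs
  have hind : ∀ x, s.indicator (fun o : Option E => o.elim 1 f) (some x) =
      (some ⁻¹' s).indicator f x := fun x => by
    by_cases hx : some x ∈ s <;> simp [hx]
  rw [withDensity_apply _ hs, ← lintegral_indicator hs,
    lintegral_option_mixture _ _ _ (hf'.indicator hs)]
  simp only [hind, lintegral_indicator hs', ← withDensity_apply _ hs', Measure.add_apply,
    Measure.smul_apply, Measure.map_apply measurable_option_some hs, smul_eq_mul,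
    Measure.dirac_apply' _ hs]
  by_cases h : none ∈ s <;> simp [h]

theorem option_mixture_absolutelyContinuous_iff {a : ℝ≥0∞} (ha : a ≠ 0) (b : ℝ≥0∞)
    (P Q : Measure E) [SigmaFinite P] [SigmaFinite Q] :
    (a • P.map some + b • Measure.dirac (none : Option E) ≪
      a • Q.map some + b • Measure.dirac (none : Option E)) ↔ P ≪ Q := by
  constructor
  · intro h
    refine Measure.AbsolutelyContinuous.mk fun s hs hQ => ?_
    have hpre : some ⁻¹' (some '' s : Set (Option E)) = s :=
      Set.preimage_image_eq _ (Option.some_injective E)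
    have hs' : MeasurableSet (some '' s : Set (Option E)) :=
      measurableSet_option_iff.2 (by rwa [hpre])
    have := @h (some '' s) (by
      simp [Measure.map_apply measurable_option_some hs', hpre, hQ, Measure.dirac_apply' _ hs'])
    simpa [Measure.map_apply measurable_option_some hs', hpre, ha,
      Measure.dirac_apply' _ hs'] using this
  · intro h
    rw [← Measure.withDensity_rnDeriv_eq P Q h,
      ← option_mixture_withDensity _ _ _ (Measure.measurable_rnDeriv P Q)]
    exact withDensity_absolutelyContinuous _ _

end Option

section KullbackLeibler

theorem klDiv_eq_informationTheory_klDiv {α : Type*} [MeasurableSpace α] (P Q : Measure α)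
    [IsProbabilityMeasure P] [IsProbabilityMeasure Q] :
    klDiv P Q = InformationTheory.klDiv P Q := by
  rw [klDiv, InformationTheory.klDiv_def]
  simp only [llr_def, probReal_univ, add_sub_cancel_right]
  congr

variable {α β : Type*} [MeasurableSpace α] [MeasurableSpace β]

theorem informationTheory_klDiv_option_mixture {a b : ℝ≥0∞} (ha : a ≠ ∞) (hb : b ≠ ∞)
    (P Q : Measure α) [IsFiniteMeasure P] [IsFiniteMeasure Q] :
    InformationTheory.klDiv (a • P.map some + b • Measure.dirac (none : Option α))
      (a • Q.map some + b • Measure.dirac (none : Option α)) =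
      a * InformationTheory.klDiv P Q := by
  have hfin : ∀ R : Measure α, IsFiniteMeasure R →
      IsFiniteMeasure (a • R.map some + b • Measure.dirac (none : Option α)) := fun R _ => by
    have := Measure.smul_finite (R.map some) ha
    have := Measure.smul_finite (Measure.dirac (none : Option α)) hb
    infer_instance
  have hP := hfin P inferInstance
  have hQ := hfin Q inferInstance
  rcases eq_or_ne a 0 with rfl | ha0
  · simp only [zero_smul, zero_add, zero_mul] at hP ⊢
    exact InformationTheory.klDiv_self _
  by_cases hac : P ≪ Q
  · have hac' := (option_mixture_absolutelyContinuous_iff ha0 b P Q).2 hac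
    have hmeas : Measurable fun o : Option α => o.elim 1 (P.rnDeriv Q) :=
      measurable_option_iff.2 (Measure.measurable_rnDeriv P Q)
    have hrn := Measure.rnDeriv_withDensity
      (a • Q.map some + b • Measure.dirac (none : Option α)) hmeas
    rw [option_mixture_withDensity _ _ _ (Measure.measurable_rnDeriv P Q),
      Measure.withDensity_rnDeriv_eq P Q hac] at hrn
    rw [InformationTheory.klDiv_eq_lintegral_klFun_of_ac hac',
      InformationTheory.klDiv_eq_lintegral_klFun_of_ac hac,
      lintegral_congr_ae (g := fun o : Option α => ENNReal.ofReal
        (InformationTheory.klFun (o.elim 1 (P.rnDeriv Q)).toReal))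
        (hrn.mono fun o ho => by simp only [ho]),
      lintegral_option_mixture _ _ _ (by fun_prop)]
    simp [InformationTheory.klFun_one]
  · rw [InformationTheory.klDiv_of_not_ac hac, InformationTheory.klDiv_of_not_ac
      (mt (option_mixture_absolutelyContinuous_iff ha0 b P Q).1 hac), ENNReal.mul_top ha0]

theorem informationTheory_klDiv_map_measurableEquiv (e : α ≃ᵐ β) (P Q : Measure α)
    [IsFiniteMeasure P] [IsFiniteMeasure Q] :
    InformationTheory.klDiv (P.map e) (Q.map e) = InformationTheory.klDiv P Q := by
  refine le_antisymm (InformationTheory.klDiv_map_le P Q e.measurable) ?_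
  simpa using InformationTheory.klDiv_map_le (P.map e) (Q.map e) e.symm.measurable

theorem informationTheory_klDiv_prod (P P' : Measure α) (Q Q' : Measure β)
    [IsProbabilityMeasure P] [IsProbabilityMeasure P']
    [IsProbabilityMeasure Q] [IsProbabilityMeasure Q'] :
    InformationTheory.klDiv (P.prod Q) (P'.prod Q') =
      InformationTheory.klDiv P P' + InformationTheory.klDiv Q Q' := by
  have hswap : InformationTheory.klDiv (P.prod Q) (P.prod Q') =
      InformationTheory.klDiv (Q.prod P) (Q'.prod P) := by
    rw [← informationTheory_klDiv_map_measurableEquiv MeasurableEquiv.prodComm]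
    simp [MeasurableEquiv.prodComm, Measure.prod_swap]
  have hright := InformationTheory.klDiv_compProd_left Q Q' (Kernel.const β P)
  have hchain := InformationTheory.klDiv_compProd_eq_add P P' (Kernel.const α Q) (Kernel.const α Q')
  simp only [Measure.compProd_const] at hright hchain
  rw [hchain, hswap, hright]

theorem informationTheory_klDiv_pi_fin {n : ℕ} (μ ν : Fin n → Measure α)
    [∀ i, IsProbabilityMeasure (μ i)] [∀ i, IsProbabilityMeasure (ν i)] :
    InformationTheory.klDiv (Measure.pi μ) (Measure.pi ν) =
      ∑ i, InformationTheory.klDiv (μ i) (ν i) := by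
  induction n with
  | zero =>
    rw [Subsingleton.elim μ ν, InformationTheory.klDiv_self, Fin.sum_univ_zero]
  | succ n ih =>
    rw [← informationTheory_klDiv_map_measurableEquiv
      (MeasurableEquiv.piFinSuccAbove (fun _ => α) 0),
      (measurePreserving_piFinSuccAbove μ 0).map_eq, (measurePreserving_piFinSuccAbove ν 0).map_eq,
      informationTheory_klDiv_prod, ih, Fin.sum_univ_succ]
    simp

theorem informationTheory_klDiv_pi {ι : Type*} [Fintype ι] (μ ν : ι → Measure α)
    [∀ i, IsProbabilityMeasure (μ i)] [∀ i, IsProbabilityMeasure (ν i)] :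
    InformationTheory.klDiv (Measure.pi μ) (Measure.pi ν) =
      ∑ i, InformationTheory.klDiv (μ i) (ν i) := by
  let e := (Fintype.equivFin ι).symm
  rw [← Measure.pi_map_piCongrLeft e μ, ← Measure.pi_map_piCongrLeft e ν,
    informationTheory_klDiv_map_measurableEquiv, informationTheory_klDiv_pi_fin]
  exact e.sum_comp fun i => InformationTheory.klDiv (μ i) (ν i)

end KullbackLeibler

/-- the KL divergence between the observation distributions generated by
two matrices tensorizes: it equals `γ` times the sum of entrywise KL divergences. -/
theorem klDiv_obsMeasure {E : Type*} [MeasurableSpace E] (P : ℝ → Measure E)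
    (hprob : ∀ x, IsProbabilityMeasure (P x)) (hmeas : Measurable P)
    (n₁ n₂ : ℕ) (hn₁ : 0 < n₁) (hn₂ : 0 < n₂) (γ : ℝ≥0∞) (hγ : γ ≤ 1)
    (X X' : Matrix (Fin n₁) (Fin n₂) ℝ) :
    klDiv (obsMeasure P γ X) (obsMeasure P γ X') =
      γ * ∑ p : Fin n₁ × Fin n₂, klDiv (P (X p.1 p.2)) (P (X' p.1 p.2)) := by
  have hγ_top : γ ≠ ∞ := ne_top_of_le_ne_top ENNReal.one_ne_top hγ
  have hmix : ∀ x, IsProbabilityMeasure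
      (γ • (P x).map Option.some + (1 - γ) • Measure.dirac (none : Option E)) := fun x => by
    have := Measure.isProbabilityMeasure_map (μ := P x) measurable_option_some.aemeasurable
    exact ⟨by simp [add_tsub_cancel_of_le hγ]⟩
  have hobs : ∀ Y : Matrix (Fin n₁) (Fin n₂) ℝ, IsProbabilityMeasure (obsMeasure P γ Y) :=
    fun Y => by unfold obsMeasure; infer_instance
  rw [klDiv_eq_informationTheory_klDiv, obsMeasure, obsMeasure, informationTheory_klDiv_pi,
    Finset.mul_sum]
  refine Finset.sum_congr rfl fun p _ => ?_
  rw [informationTheory_klDiv_option_mixture hγ_top (ENNReal.sub_ne_top ENNReal.one_ne_top),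
    klDiv_eq_informationTheory_klDiv]

end
end

section
/- Let n₁, n₂ ≥ 2 and 1 ≤ r ≤ min(n₁,n₂) be integers, let k be an integer with n₂ ≤ k ≤ r·n₂ and k ≥ 8, and let A_max > 0 and 0 < a₀ ≤ A_max be reals. Set r′ := ⌈k/n₂⌉. Then there exists a finite set 𝒳⁰ of n₁×n₂ real matrices such that: (i) the zero matrix belongs to 𝒳⁰; (ii) |𝒳⁰| ≥ 2^{k/8} + 1; (iii) every X ∈ 𝒳⁰ belongs to 𝒳(r,k,A_max), and indeed X = D·A for some D ∈ ℝ^{n₁×r} with all entries in {0,1} and some A ∈ ℝ^{r×n₂} with all entries in {0, a₀} and at most k nonzero entries; and (iv) for any two distinct X₁, X₂ ∈ 𝒳⁰, ‖X₁ − X₂‖²_F ≥ (k/8)·⌊n₁/r′⌋·a₀² ≥ (n₁n₂/32)·a₀². -/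
open MeasureTheory ProbabilityTheory
open scoped ENNReal NNReal

noncomputable section

section VarshamovGilbert

/-- The generating function of the Hamming distances to a fixed binary word. -/
theorem sum_pow_hammingDist {k : ℕ} (c : Fin k → Bool) (x : ℝ) :
    ∑ w : Fin k → Bool, x ^ hammingDist c w = (1 + x) ^ k := by
  have hterm (w : Fin k → Bool) :
      x ^ hammingDist c w = ∏ i, if c i ≠ w i then x else 1 := by
    rw [Finset.prod_ite, Finset.prod_const, Finset.prod_const_one, mul_one]
    rfl
  have hfactor (i : Fin k) : ∑ b : Bool, (if c i ≠ b then x else 1) = 1 + x := by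
    cases c i <;> simp [add_comm]
  simp_rw [hterm, ← Fintype.prod_sum (fun i b => if c i ≠ b then x else 1), hfactor]
  simp

theorem card_hammingBall_le {k : ℕ} (c : Fin k → Bool) :
    ((Finset.univ.filter fun w : Fin k → Bool => 8 * hammingDist c w < k).card : ℝ)
      ≤ (5 / 4) ^ k * 4 ^ ((k : ℝ) / 8) := by
  have hpos : (0 : ℝ) < 4 ^ ((k : ℝ) / 8) := by positivity
  rw [Finset.card_eq_sum_ones, Nat.cast_sum]
  calc ∑ w ∈ Finset.univ.filter (fun w : Fin k → Bool => 8 * hammingDist c w < k), ((1 : ℕ) : ℝ)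
      ≤ ∑ w ∈ Finset.univ.filter (fun w : Fin k → Bool => 8 * hammingDist c w < k),
          (1 / 4 : ℝ) ^ hammingDist c w * 4 ^ ((k : ℝ) / 8) := by
        refine Finset.sum_le_sum fun w hw => ?_
        have hw' : 8 * (hammingDist c w : ℝ) < k := by
          exact_mod_cast (Finset.mem_filter.1 hw).2
        rw [one_div, inv_pow, ← Real.rpow_natCast, ← Real.rpow_neg (by norm_num),
          ← Real.rpow_add (by norm_num)]
        rw [Nat.cast_one]
        exact Real.one_le_rpow (by norm_num) (by linarith)
    _ ≤ ∑ w : Fin k → Bool, (1 / 4 : ℝ) ^ hammingDist c w * 4 ^ ((k : ℝ) / 8) :=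
        Finset.sum_le_sum_of_subset_of_nonneg (Finset.filter_subset _ _)
          fun _ _ _ => by positivity
    _ = (5 / 4) ^ k * 4 ^ ((k : ℝ) / 8) := by
        rw [← Finset.sum_mul, sum_pow_hammingDist]
        norm_num

theorem hammingBall_bound_mul_le {k : ℕ} (hk : 8 ≤ k) :
    (5 / 4 : ℝ) ^ k * 4 ^ ((k : ℝ) / 8) * (2 ^ ((k : ℝ) / 8) + 1) ≤ 2 ^ k := by
  have hk' : (8 : ℝ) ≤ k := by exact_mod_cast hk
  set t : ℝ := 2 ^ ((k : ℝ) / 8) with ht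
  have ht2 : 2 ≤ t := by
    calc (2 : ℝ) = 2 ^ (1 : ℝ) := by norm_num
      _ ≤ t := Real.rpow_le_rpow_of_exponent_le (by norm_num) (by linarith)
  have h4 : (4 : ℝ) ^ ((k : ℝ) / 8) = t ^ 2 := by
    rw [show (4 : ℝ) = 2 * 2 by norm_num, Real.mul_rpow (by norm_num) (by norm_num), sq]
  have ht4 : t ^ 4 = Real.sqrt 2 ^ k := by
    rw [ht, ← Real.rpow_natCast, ← Real.rpow_mul (by norm_num), Real.sqrt_eq_rpow,
      ← Real.rpow_natCast, ← Real.rpow_mul (by norm_num)]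
    congr 1
    push_cast
    ring
  have hsqrt : 5 / 4 * Real.sqrt 2 ≤ 2 := by
    nlinarith [Real.sq_sqrt (show (0 : ℝ) ≤ 2 by norm_num), Real.sqrt_nonneg 2]
  calc (5 / 4 : ℝ) ^ k * 4 ^ ((k : ℝ) / 8) * (t + 1)
      = (5 / 4 : ℝ) ^ k * (t ^ 2 * (t + 1)) := by rw [h4]; ring
    _ ≤ (5 / 4 : ℝ) ^ k * (t ^ 2 * t ^ 2) := by gcongr; nlinarith
    _ = (5 / 4 * Real.sqrt 2) ^ k := by rw [mul_pow, ← ht4]; ring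
    _ ≤ 2 ^ k := by gcongr

/-- The **Varshamov–Gilbert bound** for binary codes of relative distance `1 / 8`. -/
theorem exists_binary_code {k : ℕ} (hk : 8 ≤ k) :
    ∃ S : Finset (Fin k → Bool), (fun _ => false) ∈ S ∧
      (2 : ℝ) ^ ((k : ℝ) / 8) + 1 ≤ S.card ∧
      ∀ w ∈ S, ∀ w' ∈ S, w ≠ w' → k ≤ 8 * hammingDist w w' := by
  obtain ⟨S, -, hS⟩ := (Set.toFinite {S : Finset (Fin k → Bool) | (fun _ => false) ∈ S ∧
    ∀ w ∈ S, ∀ w' ∈ S, w ≠ w' → k ≤ 8 * hammingDist w w'}).exists_le_maximal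
    (a := {fun _ => false}) (by simp)
  obtain ⟨h0, hdist⟩ := hS.prop
  refine ⟨S, h0, ?_, hdist⟩
  have hcover : (Finset.univ : Finset (Fin k → Bool)) ⊆
      S.biUnion fun c => Finset.univ.filter fun w => 8 * hammingDist c w < k := by
    intro w _
    by_contra hw
    simp only [Finset.mem_biUnion, Finset.mem_filter, Finset.mem_univ, true_and, not_exists,
      not_and, not_lt] at hw
    have hins : insert w S ∈ {S : Finset (Fin k → Bool) | (fun _ => false) ∈ S ∧
        ∀ w ∈ S, ∀ w' ∈ S, w ≠ w' → k ≤ 8 * hammingDist w w'} := by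
      refine ⟨Finset.mem_insert_of_mem h0, fun u hu u' hu' hne => ?_⟩
      rcases Finset.mem_insert.1 hu with hw_u | hu <;>
        rcases Finset.mem_insert.1 hu' with hw_u' | hu'
      · exact absurd (hw_u.trans hw_u'.symm) hne
      · rw [hw_u, hammingDist_comm]; exact hw u' hu'
      · rw [hw_u']; exact hw u hu
      · exact hdist u hu u' hu' hne
    have hwS : w ∈ S := hS.le_of_ge hins (Finset.subset_insert w S) (Finset.mem_insert_self w S)
    have := hw w hwS
    rw [hammingDist_self] at this
    omega
  have hcount : (2 : ℝ) ^ k ≤ S.card * ((5 / 4) ^ k * 4 ^ ((k : ℝ) / 8)) := by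
    calc (2 : ℝ) ^ k = ((Finset.univ : Finset (Fin k → Bool)).card : ℝ) := by simp
      _ ≤ ∑ c ∈ S,
          ((Finset.univ.filter fun w : Fin k → Bool => 8 * hammingDist c w < k).card : ℝ) := by
        exact_mod_cast (Finset.card_le_card hcover).trans Finset.card_biUnion_le
      _ ≤ ∑ _c ∈ S, (5 / 4 : ℝ) ^ k * 4 ^ ((k : ℝ) / 8) :=
        Finset.sum_le_sum fun c _ => card_hammingBall_le c
      _ = _ := by rw [Finset.sum_const, nsmul_eq_mul]
  have hV : (0 : ℝ) < (5 / 4) ^ k * 4 ^ ((k : ℝ) / 8) := by positivity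
  refine le_of_mul_le_mul_left ?_ hV
  linarith [hammingBall_bound_mul_le hk]

end VarshamovGilbert

section WordMatrix

theorem sum_range_mul_mod (f : ℕ → ℝ) (q r : ℕ) :
    ∑ i ∈ Finset.range (q * r), f (i % r) = q * ∑ i ∈ Finset.range r, f i := by
  induction q with
  | zero => simp
  | succ q ih =>
    rw [add_mul, one_mul, Finset.sum_range_add, ih, Nat.cast_succ, add_mul, one_mul]
    congr 1
    refine Finset.sum_congr rfl fun i hi => ?_
    rw [Nat.mul_add_mod_self_right, Nat.mod_eq_of_lt (Finset.mem_range.1 hi)]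

theorem sum_range_mul_eq_sum_sum (f : ℕ → ℝ) (m n : ℕ) :
    ∑ p ∈ Finset.range (m * n), f p =
      ∑ a ∈ Finset.range m, ∑ j ∈ Finset.range n, f (a * n + j) := by
  induction m with
  | zero => simp
  | succ m ih => rw [add_mul, one_mul, Finset.sum_range_add, ih, Finset.sum_range_succ]

/-- The word `w`, with letters `0` and `a`, continued by zeros. -/
def wordSeq {k : ℕ} (a : ℝ) (w : Fin k → Bool) (p : ℕ) : ℝ :=
  if h : p < k then (if w ⟨p, h⟩ then a else 0) else 0

theorem wordSeq_eq_zero_or {k : ℕ} (a : ℝ) (w : Fin k → Bool) (p : ℕ) :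
    wordSeq a w p = 0 ∨ wordSeq a w p = a := by
  unfold wordSeq; split_ifs <;> simp

theorem lt_of_wordSeq_ne_zero {k : ℕ} {a : ℝ} {w : Fin k → Bool} {p : ℕ}
    (h : wordSeq a w p ≠ 0) : p < k := by
  by_contra hp
  exact h (dif_neg hp)

theorem sum_sq_wordSeq_sub {k : ℕ} (a : ℝ) (w w' : Fin k → Bool) :
    ∑ p ∈ Finset.range k, (wordSeq a w p - wordSeq a w' p) ^ 2 = hammingDist w w' * a ^ 2 := by
  rw [Finset.sum_range]
  have hterm (p : Fin k) : (wordSeq a w p - wordSeq a w' p) ^ 2 =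
      if w p ≠ w' p then a ^ 2 else 0 := by
    cases h : w p <;> cases h' : w' p <;> simp [wordSeq, h, h']
  simp_rw [hterm]
  rw [Finset.sum_ite, Finset.sum_const, Finset.sum_const_zero, add_zero, nsmul_eq_mul]
  rfl

/-- The sparse factor: the word `w` written row by row. -/
def wordFactor {k : ℕ} (r n₂ : ℕ) (a : ℝ) (w : Fin k → Bool) : Matrix (Fin r) (Fin n₂) ℝ :=
  fun i j => wordSeq a w (i * n₂ + j)

/-- The `{0,1}` dictionary repeating the first `r'` rows periodically. -/
def periodicDict (n₁ r r' : ℕ) : Matrix (Fin n₁) (Fin r) ℝ :=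
  fun i j => if (i : ℕ) % r' = j then 1 else 0

theorem periodicDict_mul_wordFactor_apply {k n₁ n₂ r r' : ℕ} (hr' : 0 < r') (hr : r' ≤ r) (a : ℝ)
    (w : Fin k → Bool) (i : Fin n₁) (j : Fin n₂) :
    (periodicDict n₁ r r' * wordFactor r n₂ a w) i j = wordSeq a w (i % r' * n₂ + j) := by
  have hi : (i : ℕ) % r' < r := (Nat.mod_lt _ hr').trans_le hr
  rw [Matrix.mul_apply, Finset.sum_eq_single ⟨(i : ℕ) % r', hi⟩]
  · simp [periodicDict, wordFactor]
  · intro b _ hb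
    have : (i : ℕ) % r' ≠ b := fun h => hb (Fin.ext h.symm)
    simp [periodicDict, this]
  · simp

theorem card_support_wordFactor_le {k : ℕ} (r n₂ : ℕ) (a : ℝ) (w : Fin k → Bool) :
    (Finset.univ.filter fun p : Fin r × Fin n₂ => wordFactor r n₂ a w p.1 p.2 ≠ 0).card ≤ k := by
  conv_rhs => rw [← Finset.card_range k]
  refine Finset.card_le_card_of_injOn (fun p => p.1 * n₂ + p.2) (fun p hp => ?_) ?_
  · exact Finset.mem_coe.2 (Finset.mem_range.2 (lt_of_wordSeq_ne_zero (Finset.mem_filter.1 hp).2))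
  · rintro ⟨x, y⟩ - ⟨x', y'⟩ - h
    have h' : (finProdFinEquiv (x, y) : ℕ) = finProdFinEquiv (x', y') := by
      simp only [finProdFinEquiv_apply_val]
      simpa [mul_comm, add_comm] using h
    exact finProdFinEquiv.injective (Fin.ext h')

theorem le_frobSq_periodicDict_mul_sub {k n₁ n₂ r r' : ℕ} (hr' : 0 < r') (hr : r' ≤ r)
    (hk : k ≤ r' * n₂) (a : ℝ) (w w' : Fin k → Bool) :
    (hammingDist w w' : ℝ) * ((n₁ / r' : ℕ) : ℝ) * a ^ 2 ≤
      frobSq (periodicDict n₁ r r' * wordFactor r n₂ a w -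
        periodicDict n₁ r r' * wordFactor r n₂ a w') := by
  set u : ℕ → ℝ := fun p => (wordSeq a w p - wordSeq a w' p) ^ 2 with hu
  have hu0 (p : ℕ) : 0 ≤ u p := sq_nonneg _
  calc (hammingDist w w' : ℝ) * ((n₁ / r' : ℕ) : ℝ) * a ^ 2
      = ((n₁ / r' : ℕ) : ℝ) * ∑ p ∈ Finset.range k, u p := by
        rw [hu, sum_sq_wordSeq_sub]; ring
    _ ≤ ((n₁ / r' : ℕ) : ℝ) * ∑ p ∈ Finset.range (r' * n₂), u p := by
        gcongr
    _ = ∑ i ∈ Finset.range (n₁ / r' * r'), ∑ j ∈ Finset.range n₂, u (i % r' * n₂ + j) := by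
        rw [sum_range_mul_eq_sum_sum,
          sum_range_mul_mod (fun b => ∑ j ∈ Finset.range n₂, u (b * n₂ + j))]
    _ ≤ ∑ i ∈ Finset.range n₁, ∑ j ∈ Finset.range n₂, u (i % r' * n₂ + j) :=
        Finset.sum_le_sum_of_subset_of_nonneg
          (Finset.range_subset_range.2 (Nat.div_mul_le_self n₁ r'))
          fun _ _ _ => Finset.sum_nonneg fun _ _ => hu0 _
    _ = _ := by
        simp only [frobSq, Finset.sum_range, Matrix.sub_apply,
          periodicDict_mul_wordFactor_apply hr' hr, hu]

end WordMatrix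

/-- existence of the packing set built from the sparse factor `A`
(via the Varshamov–Gilbert bound). -/
theorem packing_set_sparse_factor (n₁ n₂ r k : ℕ) (h₁ : 2 ≤ n₁) (h₂ : 2 ≤ n₂)
    (hr₁ : 1 ≤ r) (hr₂ : r ≤ min n₁ n₂) (hk₁ : n₂ ≤ k) (hk₂ : k ≤ r * n₂) (hk₈ : 8 ≤ k)
    (Amax a₀ : ℝ) (hA : 0 < Amax) (ha₀ : 0 < a₀) (ha₀A : a₀ ≤ Amax)
    (r' : ℕ) (hr' : r' = ⌈(k : ℝ) / (n₂ : ℝ)⌉₊) :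
    ∃ 𝒳 : Finset (Matrix (Fin n₁) (Fin n₂) ℝ),
      (0 : Matrix (Fin n₁) (Fin n₂) ℝ) ∈ 𝒳 ∧
      (2 : ℝ) ^ ((k : ℝ) / 8) + 1 ≤ (𝒳.card : ℝ) ∧
      (∀ X ∈ 𝒳, X ∈ sparseClass n₁ n₂ r k Amax ∧
        ∃ (D : Matrix (Fin n₁) (Fin r) ℝ) (A : Matrix (Fin r) (Fin n₂) ℝ),
          X = D * A ∧ (∀ i j, D i j = 0 ∨ D i j = 1) ∧
          (∀ i j, A i j = 0 ∨ A i j = a₀) ∧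
          (Finset.univ.filter fun p : Fin r × Fin n₂ => A p.1 p.2 ≠ 0).card ≤ k) ∧
      (∀ X₁ ∈ 𝒳, ∀ X₂ ∈ 𝒳, X₁ ≠ X₂ →
        (k : ℝ) / 8 * ((n₁ / r' : ℕ) : ℝ) * a₀ ^ 2 ≤ frobSq (X₁ - X₂)) ∧
      (n₁ : ℝ) * n₂ / 32 * a₀ ^ 2 ≤ (k : ℝ) / 8 * ((n₁ / r' : ℕ) : ℝ) * a₀ ^ 2 := by
  have hn₂ : (0 : ℝ) < n₂ := by exact_mod_cast (by omega : 0 < n₂)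
  have hkpos : (0 : ℝ) < k := by exact_mod_cast (by omega : 0 < k)
  have hr'pos : 0 < r' := hr' ▸ Nat.ceil_pos.2 (by positivity)
  have hr'r : r' ≤ r := by
    rw [hr', Nat.ceil_le, div_le_iff₀ hn₂]
    exact_mod_cast hk₂
  have hkr' : k ≤ r' * n₂ := by
    have := Nat.le_ceil ((k : ℝ) / n₂)
    rw [← hr', div_le_iff₀ hn₂] at this
    exact_mod_cast this
  have hr'n₁ : r' ≤ n₁ := hr'r.trans (hr₂.trans (min_le_left _ _))
  have hq : 0 < n₁ / r' := Nat.div_pos hr'n₁ hr'pos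
  have hqpos : (0 : ℝ) < ((n₁ / r' : ℕ) : ℝ) := by exact_mod_cast hq
  obtain ⟨S, h0, hcard, hdist⟩ := exists_binary_code hk₈
  set X : (Fin k → Bool) → Matrix (Fin n₁) (Fin n₂) ℝ :=
    fun w => periodicDict n₁ r r' * wordFactor r n₂ a₀ w with hX
  have hsep : ∀ w ∈ S, ∀ w' ∈ S, w ≠ w' →
      (k : ℝ) / 8 * ((n₁ / r' : ℕ) : ℝ) * a₀ ^ 2 ≤ frobSq (X w - X w') := by
    intro w hw w' hw' hne
    refine le_trans ?_ (le_frobSq_periodicDict_mul_sub hr'pos hr'r hkr' a₀ w w')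
    have : (k : ℝ) ≤ 8 * hammingDist w w' := by exact_mod_cast hdist w hw w' hw' hne
    gcongr
    linarith
  have hinj : Set.InjOn X S := by
    intro w hw w' hw' heq
    by_contra hne
    have hle := hsep w hw w' hw' hne
    have hpos : 0 < (k : ℝ) / 8 * ((n₁ / r' : ℕ) : ℝ) * a₀ ^ 2 := by positivity
    rw [heq, sub_self] at hle
    simp only [frobSq, Matrix.zero_apply, ne_eq, OfNat.ofNat_ne_zero, not_false_eq_true, zero_pow,
      Finset.sum_const_zero] at hle
    linarith
  classical
  refine ⟨S.image X, ?_, ?_, ?_, ?_, ?_⟩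
  · refine Finset.mem_image.2 ⟨_, h0, ?_⟩
    ext i j
    simp [hX, periodicDict_mul_wordFactor_apply hr'pos hr'r, wordSeq]
  · rwa [Finset.card_image_of_injOn hinj]
  · intro Y hY
    obtain ⟨w, -, rfl⟩ := Finset.mem_image.1 hY
    have hD (i : Fin n₁) (j : Fin r) :
        periodicDict n₁ r r' i j = 0 ∨ periodicDict n₁ r r' i j = 1 := by
      unfold periodicDict; split_ifs <;> simp
    have hF (i : Fin r) (j : Fin n₂) :
        wordFactor r n₂ a₀ w i j = 0 ∨ wordFactor r n₂ a₀ w i j = a₀ :=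
      wordSeq_eq_zero_or _ _ _
    have hsupp := card_support_wordFactor_le r n₂ a₀ w
    refine ⟨⟨_, _, rfl, fun i j => ?_, hsupp, fun i j => ?_⟩, _, _, rfl, hD, hF, hsupp⟩
    · rcases hD i j with h | h <;> simp [h]
    · rcases hF i j with h | h
      · simp [h, hA.le]
      · rwa [h, abs_of_pos ha₀]
  · intro X₁ hX₁ X₂ hX₂ hne
    obtain ⟨w, hw, rfl⟩ := Finset.mem_image.1 hX₁
    obtain ⟨w', hw', rfl⟩ := Finset.mem_image.1 hX₂
    exact hsep w hw w' hw' fun h => hne (congrArg X h)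
  · have hn₁ : (n₁ : ℝ) ≤ 2 * (r' * ((n₁ / r' : ℕ) : ℝ)) := by
      have hdiv := Nat.div_add_mod n₁ r'
      have hmod := Nat.mod_lt n₁ hr'pos
      have hle : r' ≤ r' * (n₁ / r') := Nat.le_mul_of_pos_right _ hq
      exact_mod_cast (by omega : n₁ ≤ 2 * (r' * (n₁ / r')))
    have hr'n₂ : (r' : ℝ) * n₂ ≤ 2 * k := by
      have hlt : (r' : ℝ) < k / n₂ + 1 := hr' ▸ Nat.ceil_lt_add_one (by positivity)
      have hmul : (r' : ℝ) * n₂ ≤ (k / n₂ + 1) * n₂ := by gcongr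
      have hk₁' : (n₂ : ℝ) ≤ k := by exact_mod_cast hk₁
      rw [add_mul, one_mul, div_mul_cancel₀ _ hn₂.ne'] at hmul
      linarith
    gcongr
    have hfst : (n₁ : ℝ) * n₂ ≤ 2 * (r' * ((n₁ / r' : ℕ) : ℝ)) * n₂ := by gcongr
    have hsnd : (r' : ℝ) * n₂ * ((n₁ / r' : ℕ) : ℝ) ≤ 2 * k * ((n₁ / r' : ℕ) : ℝ) := by gcongr
    linarith

end
end

section
/- Let n₁, n₂ ≥ 2 and 1 ≤ r ≤ min(n₁,n₂) be integers with n₁·r ≥ 8, let k be an integer with r ≤ k ≤ r·n₂, and let A_max > 0 and 0 < d₀ ≤ 1 be reals. Then there exists a finite set 𝒳⁰ of n₁×n₂ real matrices such that: (i) the zero matrix belongs to 𝒳⁰; (ii) |𝒳⁰| ≥ 2^{n₁r/8} + 1; (iii) every X ∈ 𝒳⁰ belongs to 𝒳(r,k,A_max), and indeed X = D·A for some D ∈ ℝ^{n₁×r} with all entries in {0, d₀} and some A ∈ ℝ^{r×n₂} with all entries in {0, A_max} and at most min(k,n₂) nonzero entries; and (iv) for any two distinct X₁, X₂ ∈ 𝒳⁰,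 ‖X₁ − X₂‖²_F ≥ (n₁r/8)·⌊min(k,n₂)/r⌋·A_max²·d₀² ≥ (n₁n₂/16)·Δ(k,n₂)·A_max²·d₀². -/
open MeasureTheory ProbabilityTheory
open scoped ENNReal NNReal

noncomputable section

theorem sum_half_pow_hammingDist {ι : Type*} [Fintype ι] [DecidableEq ι] (x : ι → Bool) :
    ∑ y : ι → Bool, (1 / 2 : ℝ) ^ hammingDist x y = (3 / 2) ^ Fintype.card ι := by
  have key : ∀ y : ι → Bool,
      (1 / 2 : ℝ) ^ hammingDist x y = ∏ i, (if x i ≠ y i then (1 / 2 : ℝ) else 1) := by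
    intro y
    rw [hammingDist, Finset.prod_ite]
    simp
  simp_rw [key]
  rw [← Fintype.prod_sum (fun i b => if x i ≠ b then (1 / 2 : ℝ) else 1)]
  have hsum : ∀ i, ∑ b : Bool, (if x i ≠ b then (1 / 2 : ℝ) else 1) = 3 / 2 := by
    intro i
    cases x i <;> norm_num
  simp_rw [hsum, Finset.prod_const, Finset.card_univ]

/-- A Chernoff-type bound on the size of Hamming balls of relative radius `1 / 8`. -/
theorem card_hammingBall_pow_le {ι : Type*} [Fintype ι] [DecidableEq ι] (x : ι → Bool) :
    ((Finset.univ.filter fun y : ι → Bool => 8 * hammingDist x y < Fintype.card ι).card : ℝ) ^ 8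
      ≤ 2 ^ (6 * Fintype.card ι) := by
  set N := Fintype.card ι
  set B := Finset.univ.filter fun y : ι → Bool => 8 * hammingDist x y < N
  have hB : (B.card : ℝ) * (1 / 2) ^ (N / 8) ≤ (3 / 2) ^ N := by
    rw [← sum_half_pow_hammingDist x, ← nsmul_eq_mul]
    refine (Finset.card_nsmul_le_sum B (fun y => (1 / 2 : ℝ) ^ hammingDist x y) _ ?_).trans
      (Finset.sum_le_sum_of_subset_of_nonneg (Finset.subset_univ _) fun _ _ _ => by positivity)
    intro y hy
    have hy' : 8 * hammingDist x y < N := (Finset.mem_filter.1 hy).2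
    exact pow_le_pow_of_le_one (by norm_num) (by norm_num) (by omega)
  have h8 := pow_le_pow_left₀ (by positivity) hB 8
  have hN : (1 / 2 : ℝ) ^ N ≤ ((1 / 2) ^ (N / 8)) ^ 8 := by
    rw [← pow_mul]
    exact pow_le_pow_of_le_one (by norm_num) (by norm_num) (by omega)
  have h2 : (B.card : ℝ) ^ 8 * (1 / 2) ^ N ≤ ((3 / 2) ^ 8) ^ N := by
    calc (B.card : ℝ) ^ 8 * (1 / 2) ^ N ≤ (B.card : ℝ) ^ 8 * ((1 / 2) ^ (N / 8)) ^ 8 := by gcongr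
      _ = ((B.card : ℝ) * (1 / 2) ^ (N / 8)) ^ 8 := by rw [mul_pow]
      _ ≤ ((3 / 2) ^ N) ^ 8 := h8
      _ = ((3 / 2) ^ 8) ^ N := by rw [← pow_mul, ← pow_mul, mul_comm]
  calc (B.card : ℝ) ^ 8 = (B.card : ℝ) ^ 8 * (1 / 2) ^ N * 2 ^ N := by
        rw [mul_assoc, ← mul_pow]; norm_num
    _ ≤ ((3 / 2) ^ 8) ^ N * 2 ^ N := by gcongr
    _ = ((3 / 2) ^ 8 * 2) ^ N := by rw [mul_pow]
    _ ≤ (2 ^ 6) ^ N := by gcongr; norm_num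
    _ = 2 ^ (6 * N) := by rw [pow_mul]

/-- A maximal separated set containing a given point. -/
theorem exists_maximal_separated {α : Type*} [Fintype α] [DecidableEq α] (R : α → α → Prop)
    (hR : ∀ x y, R x y → R y x) (a : α) :
    ∃ S : Finset α, a ∈ S ∧ (∀ x ∈ S, ∀ y ∈ S, x ≠ y → R x y) ∧
      ∀ y, y ∉ S → ∃ x ∈ S, ¬ R x y := by
  classical
  obtain ⟨S, hS, hmax⟩ := Finset.exists_max_image
    (Finset.univ.filter fun S : Finset α => a ∈ S ∧ ∀ x ∈ S, ∀ y ∈ S, x ≠ y → R x y)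
    Finset.card ⟨{a}, by simp⟩
  obtain ⟨haS, hsep⟩ := (Finset.mem_filter.1 hS).2
  refine ⟨S, haS, hsep, fun y hy => ?_⟩
  by_contra! hcon
  have hins := hmax (insert y S) (Finset.mem_filter.2 ⟨Finset.mem_univ _,
    Finset.mem_insert_of_mem haS, fun u hu v hv huv => by
      rcases Finset.mem_insert.1 hu with rfl | hu' <;> rcases Finset.mem_insert.1 hv with rfl | hv'
      · exact absurd rfl huv
      · exact hR _ _ (hcon v hv')
      · exact hcon u hu'
      · exact hsep u hu' v hv' huv⟩)
  rw [Finset.card_insert_of_notMem hy] at hins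
  omega

/-- The Varshamov–Gilbert bound. -/
theorem varshamov_gilbert {ι : Type*} [Fintype ι] [DecidableEq ι] (hN : 8 ≤ Fintype.card ι) :
    ∃ S : Finset (ι → Bool), (fun _ => false) ∈ S ∧
      (2 : ℝ) ^ ((Fintype.card ι : ℝ) / 8) + 1 ≤ (S.card : ℝ) ∧
      ∀ x ∈ S, ∀ y ∈ S, x ≠ y → Fintype.card ι ≤ 8 * hammingDist x y := by
  obtain ⟨S, h0, hsep, hcov⟩ := exists_maximal_separated
    (fun x y : ι → Bool => Fintype.card ι ≤ 8 * hammingDist x y)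
    (fun x y h => by rwa [hammingDist_comm]) (fun _ => false)
  refine ⟨S, h0, ?_, hsep⟩
  set N := Fintype.card ι with hNdef
  let B : (ι → Bool) → Finset (ι → Bool) :=
    fun x => Finset.univ.filter fun y => 8 * hammingDist x y < N
  have hbi : S.biUnion B = Finset.univ := by
    refine Finset.eq_univ_iff_forall.2 fun y => Finset.mem_biUnion.2 ?_
    by_cases hy : y ∈ S
    · exact ⟨y, hy, Finset.mem_filter.2 ⟨Finset.mem_univ _, by simp; omega⟩⟩
    · obtain ⟨x, hx, hxy⟩ := hcov y hy
      exact ⟨x, hx, Finset.mem_filter.2 ⟨Finset.mem_univ _, not_le.1 hxy⟩⟩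
  have hball : ∀ x ∈ S, ((B x).card : ℝ) ≤ 2 ^ ((6 * N : ℝ) / 8) := by
    intro x _
    refine le_of_pow_le_pow_left₀ (n := 8) (by norm_num) (by positivity) ?_
    refine (card_hammingBall_pow_le x).trans (le_of_eq ?_)
    rw [← Real.rpow_natCast, ← Real.rpow_natCast, ← Real.rpow_mul (by norm_num)]
    congr 1
    push_cast
    ring
  have hcount : (2 : ℝ) ^ (N : ℝ) ≤ S.card * 2 ^ ((6 * N : ℝ) / 8) := by
    have h : ((Finset.univ : Finset (ι → Bool)).card : ℝ) ≤ ∑ x ∈ S, ((B x).card : ℝ) := by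
      rw [← hbi]
      exact_mod_cast Finset.card_biUnion_le
    calc (2 : ℝ) ^ (N : ℝ) = ((Finset.univ : Finset (ι → Bool)).card : ℝ) := by
          rw [Finset.card_univ]; simp [hNdef]
      _ ≤ _ := h
      _ ≤ S.card * 2 ^ ((6 * N : ℝ) / 8) := by
          rw [← nsmul_eq_mul]; exact Finset.sum_le_card_nsmul _ _ _ hball
  have hsplit : (2 : ℝ) ^ (N : ℝ) =
      2 ^ ((N : ℝ) / 8) * 2 ^ ((N : ℝ) / 8) * 2 ^ ((6 * N : ℝ) / 8) := by
    rw [← Real.rpow_add (by norm_num), ← Real.rpow_add (by norm_num)]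
    congr 1
    ring
  rw [hsplit] at hcount
  have hsq := le_of_mul_le_mul_right hcount (by positivity)
  have htwo : (2 : ℝ) ≤ 2 ^ ((N : ℝ) / 8) := by
    have hN' : (8 : ℝ) ≤ N := by exact_mod_cast hN
    calc (2 : ℝ) = 2 ^ (1 : ℝ) := by simp
      _ ≤ _ := Real.rpow_le_rpow_of_exponent_le (by norm_num) (by linarith)
  nlinarith

/-- The block matrix whose `l`-th row equals `a` on the `l`-th block of `q` columns. -/
def blockMatrix (r n q : ℕ) (a : ℝ) : Matrix (Fin r) (Fin n) ℝ :=
  fun l j => if (j : ℕ) / q = l then a else 0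

theorem card_blockMatrix_support_le (r n q : ℕ) (hq : 0 < q) (a : ℝ) :
    (Finset.univ.filter fun p : Fin r × Fin n => blockMatrix r n q a p.1 p.2 ≠ 0).card
      ≤ r * q := by
  have hdiv : ∀ p : Fin r × Fin n, blockMatrix r n q a p.1 p.2 ≠ 0 → (p.2 : ℕ) / q = p.1 :=
    fun p hp => by
      by_contra h
      exact hp (if_neg h)
  rw [← Finset.card_range (r * q)]
  refine Finset.card_le_card_of_injOn (fun p => (p.2 : ℕ)) ?_ ?_
  · intro p hp
    have hp' := hdiv p (Finset.mem_filter.1 hp).2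
    simp only [Finset.coe_range, Set.mem_Iio]
    rw [← Nat.div_lt_iff_lt_mul hq, hp']
    exact p.1.2
  · intro p hp p' hp' h
    have e := hdiv p (Finset.mem_filter.1 hp).2
    have e' := hdiv p' (Finset.mem_filter.1 hp').2
    simp only at h
    refine Prod.ext (Fin.ext ?_) (Fin.ext h)
    rw [← e, ← e', h]

theorem sum_blockMatrix_sq (r n q : ℕ) (hq : 0 < q) (hrq : r * q ≤ n) (a : ℝ) (l : Fin r) :
    ∑ j, blockMatrix r n q a l j ^ 2 = q * a ^ 2 := by
  have hcard : (Finset.univ.filter fun j : Fin n => (j : ℕ) / q = l).card = q := by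
    have himg : (Finset.univ.filter fun j : Fin n => (j : ℕ) / q = l).map Fin.valEmbedding
        = Finset.Ico (l * q) ((l + 1) * q) := by
      ext j
      simp only [Finset.mem_map, Finset.mem_filter, Finset.mem_univ, true_and, Fin.valEmbedding_apply,
        Finset.mem_Ico]
      have hl : (l + 1) * q ≤ r * q := Nat.mul_le_mul_right q l.2
      constructor
      · rintro ⟨j, hj, rfl⟩
        exact ⟨(Nat.le_div_iff_mul_le hq).1 hj.ge, (Nat.div_lt_iff_lt_mul hq).1 (by omega)⟩
      · intro hj
        exact ⟨⟨j, by omega⟩, Nat.div_eq_of_lt_le hj.1 hj.2, rfl⟩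
    rw [← Finset.card_map Fin.valEmbedding, himg, Nat.card_Ico, ← Nat.sub_mul]
    simp
  simp [blockMatrix, ite_pow, Finset.sum_ite, hcard]

theorem frobSq_mul_blockMatrix {m : ℕ} (r n q : ℕ) (hq : 0 < q) (hrq : r * q ≤ n) (a : ℝ)
    (D : Matrix (Fin m) (Fin r) ℝ) :
    frobSq (D * blockMatrix r n q a) = q * a ^ 2 * ∑ i, ∑ l, D i l ^ 2 := by
  have hentry : ∀ i j, (D * blockMatrix r n q a) i j ^ 2
      = ∑ l, D i l ^ 2 * blockMatrix r n q a l j ^ 2 := by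
    intro i j
    rw [Matrix.mul_apply]
    by_cases h : (j : ℕ) / q < r
    · have hne : ∀ l : Fin r, l ≠ ⟨(j : ℕ) / q, h⟩ → blockMatrix r n q a l j = 0 :=
        fun l hl => if_neg fun e => hl (Fin.ext e.symm)
      rw [Finset.sum_eq_single ⟨(j : ℕ) / q, h⟩ (fun l _ hl => by simp [hne l hl]) (by simp),
        Finset.sum_eq_single ⟨(j : ℕ) / q, h⟩ (fun l _ hl => by simp [hne l hl]) (by simp),
        mul_pow]
    · have hz : ∀ l : Fin r, blockMatrix r n q a l j = 0 :=
        fun l => if_neg fun e => h (e.trans_lt l.2)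
      simp [hz]
  unfold frobSq
  simp_rw [hentry]
  rw [Finset.mul_sum]
  refine Finset.sum_congr rfl fun i _ => ?_
  rw [Finset.sum_comm, Finset.mul_sum]
  refine Finset.sum_congr rfl fun l _ => ?_
  rw [← Finset.mul_sum, sum_blockMatrix_sq r n q hq hrq, mul_comm]

/-- The matrix with entries in `{0, d}` encoded by a binary word. -/
def binaryMatrix {m r : ℕ} (d : ℝ) (w : Fin m × Fin r → Bool) : Matrix (Fin m) (Fin r) ℝ :=
  fun i l => if w (i, l) then d else 0

theorem sum_binaryMatrix_sub_sq {m r : ℕ} (d : ℝ) (w v : Fin m × Fin r → Bool) :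
    ∑ i, ∑ l, (binaryMatrix d w - binaryMatrix d v) i l ^ 2 = hammingDist w v * d ^ 2 := by
  rw [← Fintype.sum_prod_type']
  have h : ∀ p : Fin m × Fin r, (binaryMatrix d w - binaryMatrix d v) p.1 p.2 ^ 2
      = if w p ≠ v p then d ^ 2 else 0 := by
    intro p
    rw [Matrix.sub_apply]
    simp only [binaryMatrix, Prod.mk.eta]
    cases w p <;> cases v p <;> simp
  simp_rw [h]
  rw [Finset.sum_ite]
  simp [hammingDist]

theorem frobSq_binaryMatrix_mul_blockMatrix_sub {m : ℕ} (r n q : ℕ) (hq : 0 < q)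
    (hrq : r * q ≤ n) (a d : ℝ) (w v : Fin m × Fin r → Bool) :
    frobSq (binaryMatrix d w * blockMatrix r n q a - binaryMatrix d v * blockMatrix r n q a)
      = q * a ^ 2 * (hammingDist w v * d ^ 2) := by
  rw [← Matrix.sub_mul, frobSq_mul_blockMatrix r n q hq hrq, sum_binaryMatrix_sub_sq]

/-- existence of the packing set built from the non-sparse factor `D`
(via the Varshamov–Gilbert bound). -/
theorem packing_set_dictionary_factor (n₁ n₂ r k : ℕ) (h₁ : 2 ≤ n₁) (h₂ : 2 ≤ n₂)
    (hr₁ : 1 ≤ r) (hr₂ : r ≤ min n₁ n₂) (hnr : 8 ≤ n₁ * r) (hk₁ : r ≤ k) (hk₂ : k ≤ r * n₂)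
    (Amax d₀ : ℝ) (hA : 0 < Amax) (hd₀ : 0 < d₀) (hd₀1 : d₀ ≤ 1) :
    ∃ 𝒳 : Finset (Matrix (Fin n₁) (Fin n₂) ℝ),
      (0 : Matrix (Fin n₁) (Fin n₂) ℝ) ∈ 𝒳 ∧
      (2 : ℝ) ^ ((n₁ * r : ℝ) / 8) + 1 ≤ (𝒳.card : ℝ) ∧
      (∀ X ∈ 𝒳, X ∈ sparseClass n₁ n₂ r k Amax ∧
        ∃ (D : Matrix (Fin n₁) (Fin r) ℝ) (A : Matrix (Fin r) (Fin n₂) ℝ),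
          X = D * A ∧ (∀ i j, D i j = 0 ∨ D i j = d₀) ∧
          (∀ i j, A i j = 0 ∨ A i j = Amax) ∧
          (Finset.univ.filter fun p : Fin r × Fin n₂ => A p.1 p.2 ≠ 0).card ≤ min k n₂) ∧
      (∀ X₁ ∈ 𝒳, ∀ X₂ ∈ 𝒳, X₁ ≠ X₂ →
        (n₁ * r : ℝ) / 8 * ((min k n₂ / r : ℕ) : ℝ) * Amax ^ 2 * d₀ ^ 2 ≤
          frobSq (X₁ - X₂)) ∧
      (n₁ : ℝ) * n₂ / 16 * Delta k n₂ * Amax ^ 2 * d₀ ^ 2 ≤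
        (n₁ * r : ℝ) / 8 * ((min k n₂ / r : ℕ) : ℝ) * Amax ^ 2 * d₀ ^ 2 := by
  classical
  have hrm : r ≤ min k n₂ := le_min hk₁ (hr₂.trans (min_le_right _ _))
  set q := min k n₂ / r with hqdef
  have hq : 0 < q := Nat.div_pos hrm hr₁
  have hrqm : r * q ≤ min k n₂ := Nat.mul_div_le _ _
  have hrq : r * q ≤ n₂ := hrqm.trans (min_le_right _ _)
  have hcard : Fintype.card (Fin n₁ × Fin r) = n₁ * r := by simp
  obtain ⟨S, h0, hS, hsep⟩ := varshamov_gilbert (ι := Fin n₁ × Fin r) (by rwa [hcard])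
  rw [hcard] at hS hsep
  push_cast at hS
  let f : (Fin n₁ × Fin r → Bool) → Matrix (Fin n₁) (Fin n₂) ℝ :=
    fun w => binaryMatrix d₀ w * blockMatrix r n₂ q Amax
  have hf : ∀ w v, frobSq (f w - f v) = q * Amax ^ 2 * (hammingDist w v * d₀ ^ 2) :=
    frobSq_binaryMatrix_mul_blockMatrix_sub r n₂ q hq hrq Amax d₀
  have hinj : Function.Injective f := by
    intro w v h
    have h' := hf w v
    rw [h, sub_self] at h'
    have hz : (q : ℝ) * Amax ^ 2 * (hammingDist w v * d₀ ^ 2) = 0 := by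
      rw [← h']; simp [frobSq]
    simpa [hq.ne', hA.ne', hd₀.ne'] using hz
  have hsupp := (card_blockMatrix_support_le r n₂ q hq Amax).trans hrqm
  have hD : ∀ w (i : Fin n₁) (j : Fin r),
      binaryMatrix d₀ w i j = 0 ∨ binaryMatrix d₀ w i j = d₀ := by
    intro w i j
    unfold binaryMatrix
    split_ifs <;> simp
  have hAe : ∀ i j, blockMatrix r n₂ q Amax i j = 0 ∨ blockMatrix r n₂ q Amax i j = Amax := by
    intro i j
    unfold blockMatrix
    split_ifs <;> simp
  refine ⟨S.image f, ?_, ?_, ?_, ?_, ?_⟩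
  · refine Finset.mem_image.2 ⟨_, h0, ?_⟩
    have hzero : binaryMatrix d₀ (fun _ : Fin n₁ × Fin r => false) = 0 := by
      ext i j
      simp [binaryMatrix]
    simp only [f, hzero, Matrix.zero_mul]
  · rwa [Finset.card_image_of_injective _ hinj]
  · intro X hX
    obtain ⟨w, -, rfl⟩ := Finset.mem_image.1 hX
    refine ⟨⟨_, _, rfl, fun i j => ?_, hsupp.trans (min_le_left _ _), fun i j => ?_⟩,
      _, _, rfl, hD w, hAe, hsupp⟩
    · rcases hD w i j with h | h <;> rw [h]
      · simp
      · rwa [abs_of_pos hd₀]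
    · rcases hAe i j with h | h <;> rw [h]
      · simpa using hA.le
      · rw [abs_of_pos hA]
  · intro X₁ hX₁ X₂ hX₂ hne
    obtain ⟨w, hw, rfl⟩ := Finset.mem_image.1 hX₁
    obtain ⟨v, hv, rfl⟩ := Finset.mem_image.1 hX₂
    rw [hf]
    have hdist : (n₁ * r : ℝ) ≤ 8 * hammingDist w v := by
      exact_mod_cast hsep w hw v hv fun h => hne (by rw [h])
    calc (n₁ * r : ℝ) / 8 * q * Amax ^ 2 * d₀ ^ 2
        ≤ hammingDist w v * q * Amax ^ 2 * d₀ ^ 2 := by gcongr; linarith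
      _ = q * Amax ^ 2 * (hammingDist w v * d₀ ^ 2) := by ring
  · have hn₂ : (0 : ℝ) < n₂ := by exact_mod_cast (by omega : 0 < n₂)
    have hDelta : (n₂ : ℝ) * Delta k n₂ = (min k n₂ : ℕ) := by
      rw [Delta, mul_min_of_nonneg _ _ hn₂.le, mul_div_cancel₀ _ hn₂.ne', mul_one, min_comm]
      push_cast
      rfl
    have hle : ((min k n₂ : ℕ) : ℝ) ≤ 2 * (r * q) := by
      have hnat : min k n₂ ≤ 2 * (r * q) := by
        have hmod := Nat.div_add_mod (min k n₂) r
        have hlt := Nat.mod_lt (min k n₂) hr₁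
        have hrq' : r ≤ r * q := Nat.le_mul_of_pos_right r hq
        rw [← hqdef] at hmod
        omega
      exact_mod_cast hnat
    refine mul_le_mul_of_nonneg_right (mul_le_mul_of_nonneg_right ?_ (sq_nonneg _)) (sq_nonneg _)
    calc (n₁ : ℝ) * n₂ / 16 * Delta k n₂ = n₁ / 16 * (n₂ * Delta k n₂) := by ring
      _ ≤ n₁ / 16 * (2 * (r * q)) := by rw [hDelta]; gcongr
      _ = n₁ * r / 8 * q := by ring

end
end
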